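/- arXiv:math/0504357 — 2 statements merged into one kernel-verified Lean document; each statement's English description precedes it below -/
import Mathlib

section
/- Let X ⊆ 𝕌 be an open subset of the Urysohn space. Suppose r, ε > 0, the ball B(x, r+ε) ⊆ X, and A ⊆ B(x,r) is an infinite spaced set. Then A is dissectable with respect to the group G of all restrictions to X of bilipschitz bijections of 𝕌 that are the identity on 𝕌 ∖ X; that is, there is a nonempty open set V ⊆ X such that for every nonempty open W ⊆ V there is g ∈ G for which both the set {a ∈ A : g(a) ∈ W} and the set {a ∈ A : g is the identity on some neighborhood of a} are infinite. -/
open Metric Set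
open scoped Classical

/-- The Urysohn space: a complete separable metric space which is universal for
separable metric spaces and finitely ultrahomogeneous. -/
def IsUrysohn (U : Type) [MetricSpace U] : Prop :=
  CompleteSpace U ∧ TopologicalSpace.SeparableSpace U ∧
  (∀ (Y : Type) [MetricSpace Y] [TopologicalSpace.SeparableSpace Y],
      ∃ f : Y → U, Isometry f) ∧
  (∀ (A : Set U) (f : U → U), A.Finite →
      (∀ u ∈ A, ∀ v ∈ A, dist (f u) (f v) = dist u v) →
      ∃ g : U ≃ᵢ U, ∀ u ∈ A, g u = f u)

/-- `f` is `K`-bilipschitz on the set `A`. -/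
def BilipschitzOn {U : Type} [MetricSpace U] (K : ℝ) (f : U → U) (A : Set U) : Prop :=
  ∀ u ∈ A, ∀ v ∈ A,
    (1 / K) * dist u v ≤ dist (f u) (f v) ∧ dist (f u) (f v) ≤ K * dist u v

namespace IsUrysohn

variable {U : Type} [MetricSpace U]

/-- One-point extension property: every Katětov function on a finite set is realized. -/
theorem exists_dist_eq (hU : IsUrysohn U) {F : Set U} (hF : F.Finite) (f : U → ℝ)
    (hf₁ : ∀ p ∈ F, ∀ q ∈ F, f p ≤ f q + dist p q)
    (hf₂ : ∀ p ∈ F, ∀ q ∈ F, dist p q ≤ f p + f q) :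
    ∃ v, ∀ p ∈ F, dist v p = f p := by
  have hnonneg : ∀ p ∈ F, 0 ≤ f p := fun p hp => by
    have := hf₂ p hp p hp
    rw [dist_self] at this
    linarith
  by_cases hzero : ∃ p ∈ F, f p = 0
  · obtain ⟨p, hp, hp0⟩ := hzero
    refine ⟨p, fun q hq => le_antisymm ?_ ?_⟩
    · linarith [hf₂ p hp q hq]
    · linarith [hf₁ q hq p hp, dist_comm p q]
  push Not at hzero
  let D : Option F → Option F → ℝ := fun a b =>
    match a, b with
    | none, none => 0
    | none, some q => f q
    | some p, none => f p
    | some p, some q => dist p q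
  let _ : MetricSpace (Option F) :=
    { dist := D
      dist_self := by rintro (_ | p) <;> simp [D]
      dist_comm := by rintro (_ | p) (_ | q) <;> simp [D, dist_comm]
      dist_triangle := by
        rintro (_ | p) (_ | q) (_ | t) <;> simp only [D]
        · simp
        · simp
        · linarith [hnonneg q q.2]
        · linarith [hf₁ t t.2 q q.2, dist_comm (t : U) q, Subtype.dist_eq q t]
        · simp
        · linarith [hf₂ p p.2 t t.2, Subtype.dist_eq p t]
        · linarith [hf₁ p p.2 q q.2, Subtype.dist_eq p q]
        · exact dist_triangle _ _ _
      eq_of_dist_eq_zero := by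
        rintro (_ | p) (_ | q) h <;> simp only [D] at h
        · rfl
        · exact absurd h (hzero q q.2)
        · exact absurd h (hzero p p.2)
        · rw [eq_of_dist_eq_zero h] }
  have : Finite F := hF
  obtain ⟨-, -, huniv, hhom⟩ := hU
  obtain ⟨e, he⟩ := huniv (Option F)
  have hinj : Function.Injective fun p : F => e (some p) :=
    he.injective.comp (Option.some_injective _)
  have hleft : ∀ p : F,
      Function.extend (fun p : F => e (some p)) Subtype.val id (e (some p)) = p :=
    fun p => hinj.extend_apply _ _ p
  obtain ⟨g, hg⟩ := hhom (range fun p : F => e (some p))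
    (Function.extend (fun p : F => e (some p)) Subtype.val id) (finite_range _) (by
      rintro _ ⟨p, rfl⟩ _ ⟨q, rfl⟩
      simp only [hleft]
      exact (he.dist_eq (some p) (some q)).symm)
  refine ⟨g (e none), fun p hp => ?_⟩
  have hgp : g (e (some ⟨p, hp⟩)) = p := (hg _ ⟨⟨p, hp⟩, rfl⟩).trans (hleft _)
  calc dist (g (e none)) p = dist (g (e none)) (g (e (some ⟨p, hp⟩))) := by rw [hgp]
    _ = dist (none : Option F) (some ⟨p, hp⟩) := by rw [g.isometry.dist_eq, he.dist_eq]
    _ = f p := rfl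

/-- A finite minimum of cones `p ↦ c + dist y p` is realized on any finite set, provided that the
heights `c` and apexes `y` are compatible. -/
theorem exists_dist_eq_min_cones (hU : IsUrysohn U) (J : Finset (U × ℝ)) (hJ : J.Nonempty)
    (hcompat : ∀ j ∈ J, ∀ k ∈ J, dist j.1 k.1 ≤ j.2 + k.2) (F : Finset U) :
    ∃ v, ∀ p ∈ F, (∀ j ∈ J, dist v p ≤ j.2 + dist j.1 p) ∧
      ∃ j ∈ J, dist v p = j.2 + dist j.1 p := by
  let f : U → ℝ := fun p => J.inf' hJ fun j => j.2 + dist j.1 p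
  have hle : ∀ p, ∀ j ∈ J, f p ≤ j.2 + dist j.1 p := fun p j hj =>
    Finset.inf'_le (fun j : U × ℝ => j.2 + dist j.1 p) hj
  have hex : ∀ p, ∃ j ∈ J, f p = j.2 + dist j.1 p := fun p =>
    Finset.exists_mem_eq_inf' hJ _
  obtain ⟨v, hv⟩ := hU.exists_dist_eq F.finite_toSet f
    (fun p _ q _ => by
      obtain ⟨j, hj, hq⟩ := hex q
      linarith [hle p j hj, dist_triangle j.1 q p, dist_comm p q])
    (fun p _ q _ => by
      obtain ⟨j, hj, hp⟩ := hex p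
      obtain ⟨k, hk, hq⟩ := hex q
      linarith [hcompat j hj k hk, dist_triangle4 p j.1 k.1 q, dist_comm p j.1])
  refine ⟨v, fun p hp => ?_⟩
  rw [hv p hp]
  exact ⟨hle p, hex p⟩

end IsUrysohn

section LocalMaps

variable {U : Type} [MetricSpace U]

/-- The size of the displacement allowed at `u` for maps supported in `ball o δ`. -/
noncomputable def bump (o : U) (δ : ℝ) (u : U) : ℝ := max 0 (δ - dist u o)

theorem bump_nonneg (o : U) (δ : ℝ) (u : U) : 0 ≤ bump o δ u := le_max_left _ _

theorem bump_le_add_dist (o : U) (δ : ℝ) (u v : U) : bump o δ u ≤ bump o δ v + dist u v := by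
  refine max_le (by linarith [bump_nonneg o δ v, dist_nonneg (x := u) (y := v)]) ?_
  have : δ - dist v o ≤ bump o δ v := le_max_right _ _
  linarith [dist_triangle v u o, dist_comm u v]

/-- A relation `S` on `U` which is a partial `2`-bilipschitz bijection preserving the distance
to `o`, with displacement at most a quarter of `bump o δ`. -/
structure IsLocalBilip (o : U) (δ : ℝ) (S : Set (U × U)) : Prop where
  dist_center : ∀ p ∈ S, dist p.2 o = dist p.1 o
  displacement : ∀ p ∈ S, dist p.1 p.2 ≤ bump o δ p.1 / 4
  dist_le : ∀ p ∈ S, ∀ q ∈ S, dist p.2 q.2 ≤ 2 * dist p.1 q.1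
  le_dist : ∀ p ∈ S, ∀ q ∈ S, dist p.1 q.1 ≤ 2 * dist p.2 q.2

namespace IsLocalBilip

variable {o : U} {δ : ℝ} {S : Set (U × U)}

theorem swap (h : IsLocalBilip o δ S) : IsLocalBilip o δ (Prod.swap ⁻¹' S) where
  dist_center p hp := (h.dist_center _ hp).symm
  displacement p hp := by
    have h₁ := h.displacement _ hp
    have h₂ := h.dist_center _ hp
    simp only [Prod.fst_swap, Prod.snd_swap] at h₁ h₂
    rw [bump, ← h₂, dist_comm] at h₁
    exact h₁
  dist_le p hp q hq := h.le_dist _ hp _ hq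
  le_dist p hp q hq := h.dist_le _ hp _ hq

theorem insert_pair (h : IsLocalBilip o δ S) {u v : U} (hc : dist v o = dist u o)
    (hd : dist u v ≤ bump o δ u / 4)
    (hS : ∀ p ∈ S, dist v p.2 ≤ 2 * dist u p.1 ∧ dist u p.1 ≤ 2 * dist v p.2) :
    IsLocalBilip o δ (insert (u, v) S) where
  dist_center := by
    rintro p (rfl | hp)
    exacts [hc, h.dist_center p hp]
  displacement := by
    rintro p (rfl | hp)
    exacts [hd, h.displacement p hp]
  dist_le := by
    rintro p (rfl | hp) q (rfl | hq)
    · simp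
    · exact (hS q hq).1
    · rw [dist_comm, dist_comm p.1]
      exact (hS p hp).1
    · exact h.dist_le p hp q hq
  le_dist := by
    rintro p (rfl | hp) q (rfl | hq)
    · simp
    · exact (hS q hq).2
    · rw [dist_comm, dist_comm p.2]
      exact (hS p hp).2
    · exact h.le_dist p hp q hq

theorem exists_insert (hU : IsUrysohn U) (h : IsLocalBilip o δ S) (hS : S.Finite) (u : U) :
    ∃ v, IsLocalBilip o δ (insert (u, v) S) := by
  lift S to Finset (U × U) using hS
  have hb := bump_nonneg o δ u
  have hmid : ∀ p ∈ S, dist u p.2 ≤ dist u p.1 + (bump o δ u + dist u p.1) / 4 := fun p hp => by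
    linarith [h.displacement p hp, bump_le_add_dist o δ p.1 u, dist_triangle u p.1 p.2,
      dist_comm u p.1]
  have hmid' : ∀ p ∈ S, dist u p.1 ≤ dist u p.2 + (bump o δ u + dist u p.1) / 4 := fun p hp => by
    linarith [h.displacement p hp, bump_le_add_dist o δ p.1 u, dist_triangle u p.2 p.1,
      dist_comm u p.1, dist_comm p.1 p.2]
  have hcen : ∀ p ∈ S, dist p.2 o = dist p.1 o := h.dist_center
  obtain ⟨v, hv⟩ := hU.exists_dist_eq_min_cones
    (insert (u, bump o δ u / 4) (insert (o, dist u o)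
      (S.image fun p => (p.2, 2 * dist u p.1)))) (Finset.insert_nonempty _ _) (by
      simp only [Finset.forall_mem_insert, Finset.forall_mem_image]
      refine ⟨⟨?_, ?_, fun p hp => ?_⟩, ⟨?_, ?_, fun p hp => ?_⟩,
        fun p hp => ⟨?_, ?_, fun q hq => ?_⟩⟩
      · rw [dist_self]; linarith
      · linarith
      · linarith [hmid p hp, dist_nonneg (x := u) (y := p.1)]
      · rw [dist_comm]; linarith
      · rw [dist_self]; linarith [dist_nonneg (x := u) (y := o)]
      · linarith [hcen p hp, dist_comm o p.2, dist_triangle p.1 u o, dist_comm u p.1,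
          dist_nonneg (x := u) (y := p.1)]
      · linarith [hmid p hp, dist_nonneg (x := u) (y := p.1), dist_comm u p.2]
      · linarith [hcen p hp, dist_triangle p.1 u o, dist_comm u p.1,
          dist_nonneg (x := u) (y := p.1)]
      · linarith [h.dist_le p hp q hq, dist_triangle p.1 u q.1, dist_comm u p.1])
    (insert u (insert o (S.image Prod.snd)))
  simp only [Finset.forall_mem_insert, Finset.forall_mem_image, Finset.exists_mem_insert,
    Finset.exists_mem_image] at hv
  obtain ⟨⟨⟨hu, -⟩, -⟩, ⟨⟨-, ho, -⟩, ho'⟩, hvS⟩ := hv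
  refine ⟨v, h.insert_pair (le_antisymm ?_ ?_) ?_ fun p hp => ⟨?_, ?_⟩⟩
  · simpa using ho
  · rcases ho' with h' | h' | ⟨p, hp, h'⟩
    · linarith
    · rw [dist_self] at h'; linarith
    · linarith [hcen p hp, dist_triangle u p.1 o, dist_nonneg (x := u) (y := p.1)]
  · rw [dist_comm]
    simpa using hu
  · have := (hvS hp).1.2.2 hp
    simpa using this
  · have hun := dist_nonneg (x := u) (y := p.1)
    rcases (hvS hp).2 with h' | h' | ⟨q, hq, h'⟩
    · linarith [hmid' p hp]
    · linarith [dist_triangle u o p.1, dist_comm o p.1, dist_comm o p.2, hcen p hp,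
        dist_nonneg (x := v) (y := p.2)]
    · linarith [h.le_dist q hq p hp, dist_triangle u q.1 p.1, dist_nonneg (x := u) (y := q.1)]

theorem closure (h : IsLocalBilip o δ S) : IsLocalBilip o δ (closure S) where
  dist_center := by
    refine fun p hp => closure_minimal (t := {p : U × U | dist p.2 o = dist p.1 o})
      h.dist_center (isClosed_eq (by fun_prop) (by fun_prop)) hp
  displacement := by
    refine fun p hp => closure_minimal (t := {p : U × U | dist p.1 p.2 ≤ bump o δ p.1 / 4})
      h.displacement (isClosed_le (by fun_prop) ?_) hp
    unfold bump
    fun_prop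
  dist_le p hp q hq := by
    have hpq : (p, q) ∈ _root_.closure (S ×ˢ S) := by
      rw [closure_prod_eq]
      exact ⟨hp, hq⟩
    exact closure_minimal
      (t := {z : (U × U) × U × U | dist z.1.2 z.2.2 ≤ 2 * dist z.1.1 z.2.1})
      (fun z hz => h.dist_le _ hz.1 _ hz.2) (isClosed_le (by fun_prop) (by fun_prop)) hpq
  le_dist p hp q hq := by
    have hpq : (p, q) ∈ _root_.closure (S ×ˢ S) := by
      rw [closure_prod_eq]
      exact ⟨hp, hq⟩
    exact closure_minimal
      (t := {z : (U × U) × U × U | dist z.1.1 z.2.1 ≤ 2 * dist z.1.2 z.2.2})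
      (fun z hz => h.le_dist _ hz.1 _ hz.2) (isClosed_le (by fun_prop) (by fun_prop)) hpq

theorem exists_mem_closure [CompleteSpace U] (h : IsLocalBilip o δ S)
    (hdense : Dense (Prod.fst '' S)) (u : U) : ∃ v, (u, v) ∈ _root_.closure S := by
  obtain ⟨y, hy, hlim⟩ := mem_closure_iff_seq_limit.1 (hdense u)
  choose p hpS hpy using hy
  obtain rfl : (fun n => (p n).1) = y := funext hpy
  have hcauchy : CauchySeq fun n => (p n).2 := by
    refine Metric.cauchySeq_iff.2 fun e he => ?_
    obtain ⟨N, hN⟩ := Metric.cauchySeq_iff.1 hlim.cauchySeq (e / 2) (by positivity)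
    exact ⟨N, fun m hm n hn => by
      linarith [h.dist_le _ (hpS m) _ (hpS n), hN m hm n hn]⟩
  obtain ⟨v, hv⟩ := cauchySeq_tendsto_of_complete hcauchy
  exact ⟨v, mem_closure_of_tendsto (hlim.prodMk_nhds hv) (Filter.Eventually.of_forall hpS)⟩

/-- A finite partial map extends to a bijection of the Urysohn space. -/
theorem exists_extension (hU : IsUrysohn U) (h : IsLocalBilip o δ S) (hS : S.Finite) :
    ∃ g : U → U, Function.Bijective g ∧ IsLocalBilip o δ {p | g p.1 = p.2} ∧
      ∀ p ∈ S, g p.1 = p.2 := by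
  have := hU.1
  have := hU.2.1
  have : Nonempty U := ⟨o⟩
  let q := TopologicalSpace.denseSeq U
  let State := {T : Set (U × U) // IsLocalBilip o δ T ∧ T.Finite}
  have hstep : ∀ (n : ℕ) (T : State), ∃ T' : State, T.1 ⊆ T'.1 ∧
      (∃ v, (q n, v) ∈ T'.1) ∧ ∃ u, (u, q n) ∈ T'.1 := by
    rintro n ⟨T, hT, hfin⟩
    obtain ⟨v, hv⟩ := hT.exists_insert hU hfin (q n)
    have hfin' := hfin.insert (q n, v)
    obtain ⟨u, hu⟩ := hv.swap.exists_insert hU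
      (hfin'.preimage Prod.swap_injective.injOn) (q n)
    refine ⟨⟨_, hu.swap, ((hfin'.preimage Prod.swap_injective.injOn).insert _).preimage
      Prod.swap_injective.injOn⟩, fun p hp => ?_, ⟨v, ?_⟩, u, ?_⟩
    · exact Or.inr (Or.inr hp)
    · exact Or.inr (Or.inl rfl)
    · exact Or.inl rfl
  choose next hsub hfst hsnd using hstep
  let T : ℕ → State := fun n => Nat.rec ⟨S, h, hS⟩ next n
  have hmono : Monotone fun n => (T n).1 := monotone_nat_of_le_succ fun n => hsub n (T n)
  have hpair : ∀ p ∈ ⋃ n, (T n).1, ∀ p' ∈ ⋃ n, (T n).1, ∃ n, p ∈ (T n).1 ∧ p' ∈ (T n).1 := by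
    intro p hp p' hp'
    obtain ⟨m, hm⟩ := mem_iUnion.1 hp
    obtain ⟨n, hn⟩ := mem_iUnion.1 hp'
    exact ⟨max m n, hmono (le_max_left _ _) hm, hmono (le_max_right _ _) hn⟩
  have hunion : IsLocalBilip o δ (⋃ n, (T n).1) :=
    { dist_center := fun p hp => by
        obtain ⟨n, hn, -⟩ := hpair p hp p hp
        exact (T n).2.1.dist_center p hn
      displacement := fun p hp => by
        obtain ⟨n, hn, -⟩ := hpair p hp p hp
        exact (T n).2.1.displacement p hn
      dist_le := fun p hp p' hp' => by
        obtain ⟨n, hn, hn'⟩ := hpair p hp p' hp'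
        exact (T n).2.1.dist_le p hn p' hn'
      le_dist := fun p hp p' hp' => by
        obtain ⟨n, hn, hn'⟩ := hpair p hp p' hp'
        exact (T n).2.1.le_dist p hn p' hn' }
  have hclos := hunion.closure
  have hdense : Dense (Prod.fst '' ⋃ n, (T n).1) := by
    refine (TopologicalSpace.denseRange_denseSeq U).mono ?_
    rintro _ ⟨n, rfl⟩
    obtain ⟨v, hv⟩ := hfst n (T n)
    exact ⟨_, mem_iUnion.2 ⟨n + 1, hv⟩, rfl⟩
  have hdense' : Dense (Prod.fst '' (Prod.swap ⁻¹' ⋃ n, (T n).1)) := by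
    refine (TopologicalSpace.denseRange_denseSeq U).mono ?_
    rintro _ ⟨n, rfl⟩
    obtain ⟨u, hu⟩ := hsnd n (T n)
    exact ⟨(q n, u), mem_iUnion.2 ⟨n + 1, hu⟩, rfl⟩
  choose g hg using hunion.exists_mem_closure hdense
  have hgraph : ∀ p ∈ _root_.closure (⋃ n, (T n).1), g p.1 = p.2 := fun p hp => by
    have := hclos.dist_le _ (hg p.1) p hp
    rw [dist_self, mul_zero] at this
    exact dist_le_zero.1 this
  refine ⟨g, ⟨fun u v huv => ?_, fun v => ?_⟩, ?_, fun p hp => ?_⟩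
  · have := hclos.le_dist _ (hg u) _ (hg v)
    rw [huv, dist_self, mul_zero] at this
    exact dist_le_zero.1 this
  · obtain ⟨u, hu⟩ := hunion.swap.exists_mem_closure hdense' v
    have hswap : (v, u) ∈ Prod.swap ⁻¹' _root_.closure (⋃ n, (T n).1) :=
      continuous_swap.closure_preimage_subset _ hu
    exact ⟨u, hgraph _ hswap⟩
  · have heq : {p : U × U | g p.1 = p.2} = _root_.closure (⋃ n, (T n).1) := by
      ext p
      refine ⟨fun hp => ?_, hgraph p⟩
      have := hg p.1
      rwa [show g p.1 = p.2 from hp] at this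
    rw [heq]
    exact hclos
  · exact hgraph p (subset_closure (mem_iUnion.2 ⟨0, hp⟩))

end IsLocalBilip

/-- A point can be moved to a nearby point by a bijection supported in a ball. -/
theorem IsUrysohn.exists_local_move (hU : IsUrysohn U) {δ : ℝ} {a b : U}
    (hab : dist a b ≤ δ / 5) :
    ∃ (o : U) (g : U → U), dist a o = δ / 5 ∧ Function.Bijective g ∧
      IsLocalBilip o δ {p | g p.1 = p.2} ∧ g a = b := by
  have hδ : 0 ≤ δ / 5 := dist_nonneg.trans hab
  obtain ⟨o, ho⟩ := hU.exists_dist_eq (F := {a, b}) (by simp) (fun _ => δ / 5)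
    (fun p _ q _ => by linarith [dist_nonneg (x := p) (y := q)])
    (by
      rintro p (rfl | rfl) q (rfl | rfl)
      · rw [dist_self]; linarith
      · linarith
      · rw [dist_comm]; linarith
      · rw [dist_self]; linarith)
  have hoa : dist a o = δ / 5 := by rw [dist_comm]; exact ho a (by simp)
  have hob : dist b o = δ / 5 := by rw [dist_comm]; exact ho b (by simp)
  have hinit : IsLocalBilip o δ ({(a, b)} : Set (U × U)) :=
    { dist_center := by rintro p rfl; exact hob.trans hoa.symm
      displacement := by
        rintro p rfl
        have : δ - dist a o ≤ bump o δ a := le_max_right _ _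
        change dist a b ≤ bump o δ a / 4
        linarith
      dist_le := by rintro p rfl q rfl; simp
      le_dist := by rintro p rfl q rfl; simp }
  obtain ⟨g, hbij, hg, hgab⟩ := hinit.exists_extension hU (finite_singleton _)
  exact ⟨o, g, hoa, hbij, hg, hgab (a, b) rfl⟩

/-- The points of a spaced sequence can be moved simultaneously to nearby points. -/
theorem IsUrysohn.exists_simultaneous_move (hU : IsUrysohn U) {δ : ℝ} (hδ : 0 < δ)
    (a b : ℕ → U) (hab : ∀ n, dist (a n) (b n) ≤ δ / 5)
    (ha : ∀ m n, m ≠ n → 3 * δ ≤ dist (a m) (a n)) :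
    ∃ g : U → U, Function.Bijective g ∧ BilipschitzOn 2 g Set.univ ∧ (∀ n, g (a n) = b n) ∧
      ∀ z, (∀ n, 2 * δ ≤ dist z (a n)) → g z = z := by
  choose o g ho hbij hg hgab using fun n => hU.exists_local_move (hab n)
  have hunique : ∀ {u m n}, dist u (o m) < δ → dist u (o n) < δ → m = n := by
    intro u m n hm hn
    by_contra hne
    linarith [ha m n hne, dist_triangle4 (a m) (o m) (o n) (a n), dist_triangle (o m) u (o n),
      ho m, ho n, dist_comm (a n) (o n), dist_comm u (o m)]
  let G : U → U := fun u => if h : ∃ n, dist u (o n) < δ then g h.choose u else u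
  have hGin : ∀ {u n}, dist u (o n) < δ → G u = g n u := by
    intro u n hn
    have hex : ∃ n, dist u (o n) < δ := ⟨n, hn⟩
    simp only [G, dif_pos hex]
    rw [hunique hex.choose_spec hn]
  have hGout : ∀ {u}, (¬ ∃ n, dist u (o n) < δ) → G u = u := fun hu => dif_neg hu
  have hdisp : ∀ u v, (¬ ∃ n, dist u (o n) < δ ∧ dist v (o n) < δ) →
      dist u (G u) ≤ dist u v / 4 := by
    intro u v huv
    by_cases hu : ∃ n, dist u (o n) < δ
    · obtain ⟨n, hn⟩ := hu
      have hv : δ ≤ dist v (o n) := not_lt.1 fun hv => huv ⟨n, hn, hv⟩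
      have h₁ := (hg n).displacement (u, g n u) rfl
      have h₂ : bump (o n) δ u ≤ dist u v := max_le dist_nonneg (by
        linarith [dist_triangle v u (o n), dist_comm u v])
      rw [hGin hn]
      linarith
    · rw [hGout hu, dist_self]
      positivity
  have hbilip : ∀ u v, dist (G u) (G v) ≤ 2 * dist u v ∧ dist u v ≤ 2 * dist (G u) (G v) := by
    intro u v
    by_cases huv : ∃ n, dist u (o n) < δ ∧ dist v (o n) < δ
    · obtain ⟨n, hu, hv⟩ := huv
      rw [hGin hu, hGin hv]
      exact ⟨(hg n).dist_le (u, g n u) rfl (v, g n v) rfl,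
        (hg n).le_dist (u, g n u) rfl (v, g n v) rfl⟩
    · have h₁ := hdisp u v huv
      have h₂ := hdisp v u fun ⟨n, hn, hn'⟩ => huv ⟨n, hn', hn⟩
      constructor
      · linarith [dist_triangle4 (G u) u v (G v), dist_comm u (G u), dist_comm u v,
          dist_nonneg (x := u) (y := v)]
      · linarith [dist_triangle4 u (G u) (G v) v, dist_comm v (G v), dist_comm u v,
          dist_nonneg (x := u) (y := v)]
  refine ⟨G, ⟨fun u v huv => ?_, fun v => ?_⟩, fun u _ v _ => ⟨?_, (hbilip u v).1⟩, fun n => ?_,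
    fun z hz => hGout ?_⟩
  · have := (hbilip u v).2
    rw [huv, dist_self, mul_zero] at this
    exact dist_le_zero.1 this
  · by_cases hv : ∃ n, dist v (o n) < δ
    · obtain ⟨n, hn⟩ := hv
      obtain ⟨u, rfl⟩ := (hbij n).2 v
      have hc : dist (g n u) (o n) = dist u (o n) := (hg n).dist_center (u, g n u) rfl
      exact ⟨u, hGin (hc ▸ hn)⟩
    · exact ⟨v, hGout hv⟩
  · linarith [(hbilip u v).2]
  · rw [hGin (n := n) (by rw [ho n]; linarith), hgab]
  · rintro ⟨n, hn⟩
    linarith [hz n, dist_triangle z (o n) (a n), ho n, dist_comm (a n) (o n)]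

end LocalMaps

section Chains

variable {U : Type} [MetricSpace U]

theorem BilipschitzOn.comp {K L : ℝ} (hK : 1 ≤ K) (hL : 1 ≤ L) {f g : U → U}
    (hg : BilipschitzOn K g Set.univ) (hf : BilipschitzOn L f Set.univ) :
    BilipschitzOn (K * L) (g ∘ f) Set.univ := by
  intro u _ v _
  obtain ⟨hg₁, hg₂⟩ := hg (f u) trivial (f v) trivial
  obtain ⟨hf₁, hf₂⟩ := hf u trivial v trivial
  constructor
  · calc 1 / (K * L) * dist u v = 1 / K * (1 / L * dist u v) := by field_simp
      _ ≤ 1 / K * dist (f u) (f v) := by gcongr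
      _ ≤ dist (g (f u)) (g (f v)) := hg₁
  · calc dist (g (f u)) (g (f v)) ≤ K * dist (f u) (f v) := hg₂
      _ ≤ K * (L * dist u v) := by gcongr
      _ = K * L * dist u v := by ring

/-- Points can be moved simultaneously along chains with small steps. -/
theorem IsUrysohn.exists_chain_move (hU : IsUrysohn U) {δ : ℝ} (hδ : 0 < δ) (a : ℕ → ℕ → U)
    (N : ℕ) (hstep : ∀ n, ∀ i < N, dist (a n i) (a n (i + 1)) ≤ δ / 5)
    (ha : ∀ m n, m ≠ n → ∀ i < N, 3 * δ ≤ dist (a m i) (a n i)) :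
    ∃ g : U → U, Function.Bijective g ∧ (∃ K : ℝ, 1 ≤ K ∧ BilipschitzOn K g Set.univ) ∧
      (∀ n, g (a n 0) = a n N) ∧
      ∀ z, (∀ n, ∀ i < N, 2 * δ ≤ dist z (a n i)) → g z = z := by
  induction N with
  | zero =>
    exact ⟨id, Function.bijective_id, ⟨1, le_rfl, fun u _ v _ => by simp⟩, fun _ => rfl,
      fun _ _ => rfl⟩
  | succ N ih =>
    obtain ⟨f, hf, ⟨L, hL, hfL⟩, hfa, hfz⟩ := ih (fun n i hi => hstep n i (by omega))
      (fun m n hmn i hi => ha m n hmn i (by omega))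
    obtain ⟨g, hg, hgK, hga, hgz⟩ := hU.exists_simultaneous_move hδ (fun n => a n N)
      (fun n => a n (N + 1)) (fun n => hstep n N (by omega))
      (fun m n hmn => ha m n hmn N (by omega))
    refine ⟨g ∘ f, hg.comp hf, ⟨2 * L, by linarith, hgK.comp one_le_two hL hfL⟩, fun n => ?_,
      fun z hz => ?_⟩
    · rw [Function.comp_apply, hfa, hga]
    · rw [Function.comp_apply, hfz z fun n i hi => hz n i (by omega),
        hgz z fun n => hz n N (by omega)]

/-- Two points of a ball are joined by a chain with small steps inside the closed ball, which does
not come closer to a given finite set than its endpoints. -/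
theorem IsUrysohn.exists_chain (hU : IsUrysohn U) {x a b : U} {r σ τ : ℝ} (hσr : σ ≤ r)
    (hτ : 0 ≤ τ) (ha : dist a x ≤ r) (hb : dist b x ≤ r) (N : ℕ) (hN : dist a b ≤ N * τ)
    (P : Finset U) (haP : ∀ p ∈ P, σ ≤ dist a p) (hbP : ∀ p ∈ P, σ ≤ dist b p) :
    ∃ c : ℕ → U, c 0 = a ∧ c N = b ∧ (∀ i, dist (c i) x ≤ r) ∧
      (∀ i, dist (c i) (c (i + 1)) ≤ τ) ∧ ∀ i, ∀ p ∈ P, σ ≤ dist (c i) p := by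
  induction N generalizing a with
  | zero =>
    have hab : a = b := dist_le_zero.1 (by simpa using hN)
    subst hab
    exact ⟨fun _ => a, rfl, rfl, fun _ => ha, fun _ => by simpa using hτ, fun _ => haP⟩
  | succ N ih =>
    have hr : 0 ≤ r := dist_nonneg.trans ha
    have hNτ : 0 ≤ N * τ := by positivity
    push_cast at hN
    obtain ⟨v, hv⟩ := hU.exists_dist_eq_min_cones {(a, τ), (b, N * τ), (x, r)}
      (Finset.insert_nonempty _ _) (by
        simp only [Finset.forall_mem_insert, Finset.mem_singleton, forall_eq, dist_self]
        refine ⟨⟨?_, ?_, ?_⟩, ⟨?_, ?_, ?_⟩, ?_, ?_, ?_⟩ <;>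
          linarith [dist_comm a b, dist_comm a x, dist_comm b x])
      (insert a (insert b (insert x P)))
    simp only [Finset.forall_mem_insert, Finset.exists_mem_insert, Finset.mem_singleton,
      forall_eq, exists_eq_left, dist_self] at hv
    obtain ⟨⟨⟨hva, -⟩, -⟩, ⟨⟨-, hvb, -⟩, -⟩, ⟨⟨-, -, hvx⟩, -⟩, hvP⟩ := hv
    obtain ⟨c, hc0, hcN, hcx, hcs, hcP⟩ := ih (a := v) (by linarith) (by linarith) fun p hp => by
      rcases (hvP p hp).2 with h | h | h
      · linarith [haP p hp]
      · linarith [hbP p hp]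
      · linarith [dist_nonneg (x := x) (y := p)]
    refine ⟨fun i => Nat.casesOn i a c, rfl, hcN, ?_, ?_, ?_⟩
    · rintro (_ | i)
      exacts [ha, hcx i]
    · rintro (_ | i)
      · change dist a (c 0) ≤ τ
        rw [hc0, dist_comm]
        linarith
      · exact hcs i
    · rintro (_ | i)
      exacts [haP, hcP i]

/-- An infinite spaced set has points away from any given finite set. -/
theorem exists_mem_far_of_spaced {A : Set U} (hA : A.Infinite) {σ : ℝ}
    (hs : ∀ a ∈ A, ∀ b ∈ A, a ≠ b → 2 * σ < dist a b) (P : Finset U) :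
    ∃ a ∈ A, ∀ p ∈ P, σ ≤ dist a p := by
  have hfin : (⋃ p ∈ P, {a ∈ A | dist a p < σ}).Finite := by
    refine P.finite_toSet.biUnion fun p _ => Set.Subsingleton.finite ?_
    rintro a ⟨ha, hap⟩ b ⟨hb, hbp⟩
    by_contra hab
    linarith [hs a ha b hb hab, dist_triangle a p b, dist_comm b p]
  obtain ⟨a, ha, hna⟩ := (hA.sdiff hfin).nonempty
  refine ⟨a, ha, fun p hp => not_lt.1 fun h => hna ?_⟩
  exact Set.mem_biUnion hp ⟨ha, h⟩

end Chains

/-- An infinite spaced subset of a ball whose slightly larger ball is contained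
in the open set `X ⊆ 𝕌` is dissectable with respect to the group of
bilipschitz bijections of `𝕌` which are the identity outside `X`. -/
theorem spaced_set_dissectable (U : Type) [MetricSpace U] (hU : IsUrysohn U)
    (X : Set U) (hX : IsOpen X) (x : U) (r ε : ℝ) (hr : 0 < r) (hε : 0 < ε)
    (hball : ball x (r + ε) ⊆ X)
    (A : Set U) (hAinf : A.Infinite) (hAsub : A ⊆ ball x r)
    (hAspaced : ∃ s : ℝ, 0 < s ∧ ∀ a ∈ A, ∀ b ∈ A, a ≠ b → s < dist a b) :
    ∃ V : Set U, IsOpen V ∧ V.Nonempty ∧ V ⊆ X ∧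
      ∀ W : Set U, IsOpen W → W.Nonempty → W ⊆ V →
        ∃ g : U → U, Function.Bijective g ∧
          (∃ K : ℝ, 1 ≤ K ∧ BilipschitzOn K g Set.univ) ∧
          (∀ z ∉ X, g z = z) ∧
          {a ∈ A | g a ∈ W}.Infinite ∧
          {a ∈ A | ∃ V' : Set U, IsOpen V' ∧ a ∈ V' ∧ ∀ z ∈ V', g z = z}.Infinite := by
  obtain ⟨s, hs, hAs⟩ := hAspaced
  refine ⟨ball x r, isOpen_ball, ⟨x, mem_ball_self hr⟩,
    (ball_subset_ball (by linarith)).trans hball, fun W hW ⟨w, hw⟩ hWV => ?_⟩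
  obtain ⟨η, hη, hηW⟩ := Metric.isOpen_iff.1 hW w hw
  obtain ⟨σ, hσ, hσs, hση, hσr⟩ : ∃ σ > 0, 2 * σ ≤ s ∧ 2 * σ ≤ η ∧ σ ≤ r :=
    ⟨min (s / 2) (min (η / 2) r), by positivity,
      by linarith [min_le_left (s / 2) (min (η / 2) r)],
      by linarith [min_le_right (s / 2) (min (η / 2) r), min_le_left (η / 2) r],
      (min_le_right _ _).trans (min_le_right _ _)⟩
  obtain ⟨δ, hδ, hδσ, hδε⟩ : ∃ δ > 0, 3 * δ ≤ σ ∧ 2 * δ ≤ ε :=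
    ⟨min (σ / 3) (ε / 2), by positivity, by linarith [min_le_left (σ / 3) (ε / 2)],
      by linarith [min_le_right (σ / 3) (ε / 2)]⟩
  obtain ⟨N, hN⟩ := exists_nat_ge (2 * r / (δ / 5))
  rw [div_le_iff₀ (by positivity)] at hN
  have hfar := exists_mem_far_of_spaced hAinf fun a ha b hb hab =>
    hσs.trans_lt (hAs a ha b hb hab)
  have hchain : ∀ P : Finset U, ∃ (c : ℕ → U) (e : U), (c 0 ∈ A ∧ e ∈ A ∧ c N ∈ W ∧
      (∀ i, dist (c i) x ≤ r) ∧ (∀ i, dist (c i) (c (i + 1)) ≤ δ / 5) ∧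
      ∀ i, σ ≤ dist (c i) e) ∧
      (∀ p ∈ P, σ ≤ dist e p) ∧ ∀ i, ∀ p ∈ P, σ ≤ dist (c i) p := by
    intro P
    obtain ⟨e, heA, heP⟩ := hfar P
    obtain ⟨a, haA, haP⟩ := hfar (insert e P)
    obtain ⟨b, hb⟩ := hU.exists_dist_eq_min_cones {(w, η / 2)} (Finset.singleton_nonempty _)
      (by simp [hη.le]) (insert w (insert e P))
    simp only [Finset.mem_singleton, forall_eq, exists_eq_left] at hb
    have hbw : b ∈ ball w η := by
      rw [mem_ball, (hb w (by simp)).2, dist_self]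
      linarith
    have hax : dist a x < r := hAsub haA
    have hbx : dist b x < r := hWV (hηW hbw)
    obtain ⟨c, hc0, hcN, hcx, hcs, hcP⟩ := hU.exists_chain hσr (by positivity : 0 ≤ δ / 5)
      hax.le hbx.le N (by linarith [dist_triangle a x b, dist_comm b x]) (insert e P) haP
      (fun p hp => by
        rw [(hb p (Finset.mem_insert_of_mem hp)).2]
        linarith [dist_nonneg (x := w) (y := p)])
    exact ⟨c, e, ⟨hc0 ▸ haA, heA, hcN ▸ hηW hbw, hcx, hcs, fun i => hcP i e (by simp)⟩, heP,
      fun i p hp => hcP i p (by simp [hp])⟩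
  let far : (ℕ → U) × U → (ℕ → U) × U → Prop := fun y z => σ ≤ dist y.2 z.2 ∧
    ∀ i < N + 1, σ ≤ dist (y.1 i) (z.1 i) ∧ σ ≤ dist (y.1 i) z.2 ∧ σ ≤ dist (z.1 i) y.2
  have : Std.Symm far := ⟨fun y z h => ⟨by rw [dist_comm]; exact h.1, fun i hi =>
      ⟨by rw [dist_comm]; exact (h.2 i hi).1, (h.2 i hi).2.2, (h.2 i hi).2.1⟩⟩⟩
  obtain ⟨F, hF, hFF⟩ := exists_seq_of_forall_finset_exists' (α := (ℕ → U) × U)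
    (fun y => y.1 0 ∈ A ∧ y.2 ∈ A ∧ y.1 N ∈ W ∧ (∀ i, dist (y.1 i) x ≤ r) ∧
      (∀ i, dist (y.1 i) (y.1 (i + 1)) ≤ δ / 5) ∧ ∀ i, σ ≤ dist (y.1 i) y.2)
    far
    (fun S _ => by
      obtain ⟨c, e, hce, heP, hcP⟩ := hchain (S.image Prod.snd ∪
        S.biUnion fun y => (Finset.range (N + 1)).image y.1)
      refine ⟨(c, e), hce, fun y hy => ?_⟩
      have hy₂ : y.2 ∈ S.image Prod.snd ∪
          S.biUnion fun y => (Finset.range (N + 1)).image y.1 :=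
        Finset.mem_union_left _ (Finset.mem_image_of_mem _ hy)
      have hy₁ : ∀ i < N + 1, y.1 i ∈ S.image Prod.snd ∪
          S.biUnion fun y => (Finset.range (N + 1)).image y.1 := fun i hi =>
        Finset.mem_union_right _ (Finset.mem_biUnion.2
          ⟨y, hy, Finset.mem_image_of_mem _ (Finset.mem_range.2 hi)⟩)
      refine ⟨by rw [dist_comm]; exact heP _ hy₂, fun i hi => ⟨?_, ?_, hcP i _ hy₂⟩⟩
      · rw [dist_comm]; exact hcP i _ (hy₁ i hi)
      · rw [dist_comm]; exact heP _ (hy₁ i hi))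
  choose hA0 hAe hFW hFx hFs hFe using hF
  have hFe' : ∀ m n, ∀ i < N, σ ≤ dist ((F n).2) ((F m).1 i) := fun m n i hi => by
    rw [dist_comm]
    rcases eq_or_ne m n with rfl | hmn
    · exact hFe m i
    · exact ((hFF hmn).2 i (by omega)).2.1
  obtain ⟨g, hbij, hK, hga, hgz⟩ := hU.exists_chain_move hδ (fun n => (F n).1) N
    (fun n i _ => hFs n i) (fun m n hmn i hi => hδσ.trans ((hFF hmn).2 i (by omega)).1)
  refine ⟨g, hbij, hK, fun z hz => hgz z fun n i _ => ?_, ?_, ?_⟩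
  · have hzx : r + ε ≤ dist z x := not_lt.1 fun h => hz (hball h)
    linarith [dist_triangle z ((F n).1 i) x, hFx n i]
  · refine infinite_of_injective_forall_mem (f := fun n => (F n).1 0) (fun m n hmn => ?_)
      fun n => ⟨hA0 n, by rw [hga]; exact hFW n⟩
    by_contra hne
    have := ((hFF hne).2 0 (by omega)).1
    rw [show (F m).1 0 = (F n).1 0 from hmn, dist_self] at this
    linarith
  · refine infinite_of_injective_forall_mem (f := fun n => (F n).2) (fun m n hmn => ?_)
      fun n => ⟨hAe n, ball (F n).2 δ, isOpen_ball, mem_ball_self hδ, fun z hz =>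
        hgz z fun m i hi => ?_⟩
    · by_contra hne
      have := (hFF hne).1
      rw [show (F m).2 = (F n).2 from hmn, dist_self] at this
      linarith
    · have hz' : dist z (F n).2 < δ := hz
      linarith [hFe' m n i hi, dist_triangle (F n).2 z ((F m).1 i), dist_comm z (F n).2]
end

section
/- Reconstruction theorem: Let X and Y be nonempty open subsets of the Urysohn space 𝕌, let Γ and Δ be countably generated MC-semigroups, and let φ be a group isomorphism from H^Γ_LC(X) onto H^Δ_LC(Y). Then there is a homeomorphism τ : X → Y such that τ is locally Γ-bicontinuous, τ is locally Δ-bicontinuous, and φ(g) = τ∘g∘τ⁻¹ for every g ∈ H^Γ_LC(X). -/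
open Metric Set

/-- A modulus of continuity: a concave homeomorphism of `[0,∞)` onto itself. -/
def IsModulus (α : ℝ → ℝ) : Prop :=
  α 0 = 0 ∧ StrictMonoOn α (Set.Ici (0 : ℝ)) ∧
  MapsTo α (Set.Ici (0 : ℝ)) (Set.Ici (0 : ℝ)) ∧
  SurjOn α (Set.Ici (0 : ℝ)) (Set.Ici (0 : ℝ)) ∧
  ConcaveOn ℝ (Set.Ici (0 : ℝ)) α

/-- `α ⪯ β`: `α ≤ β` on some interval `[0,a]`, `a > 0`. -/
def MCle (α β : ℝ → ℝ) : Prop :=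
  ∃ a : ℝ, 0 < a ∧ ∀ x ∈ Set.Icc (0 : ℝ) a, α x ≤ β x

/-- An MC-semigroup: a set of moduli of continuity containing `x ↦ 2x`,
closed under composition, and downward closed under `⪯`. -/
def IsMCSemigroup (Γ : Set (ℝ → ℝ)) : Prop :=
  (∀ α ∈ Γ, IsModulus α) ∧
  ((fun x : ℝ => 2 * x) ∈ Γ) ∧
  (∀ α ∈ Γ, ∀ β ∈ Γ, (α ∘ β) ∈ Γ) ∧
  (∀ α ∈ Γ, ∀ β : ℝ → ℝ, IsModulus β → MCle β α → β ∈ Γ)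

/-- A countably generated MC-semigroup. -/
def MCCountablyGenerated (Γ : Set (ℝ → ℝ)) : Prop :=
  ∃ Γ₀ : Set (ℝ → ℝ), Γ₀ ⊆ Γ ∧ Γ₀.Countable ∧ ∀ α ∈ Γ, ∃ β ∈ Γ₀, MCle α β

/-- `f` is locally `Γ`-continuous: every point has a neighborhood on which `f`
is `α`-continuous for some `α ∈ Γ`. -/
def LocallyGammaCont (Γ : Set (ℝ → ℝ)) {A B : Type}
    [MetricSpace A] [MetricSpace B] (f : A → B) : Prop :=
  ∀ x : A, ∃ ε : ℝ, 0 < ε ∧ ∃ α ∈ Γ,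
    ∀ u v : A, dist u x < ε → dist v x < ε → dist (f u) (f v) ≤ α (dist u v)

/-- A homeomorphism is locally `Γ`-bicontinuous if both it and its inverse are
locally `Γ`-continuous. -/
def LocallyGammaBicont (Γ : Set (ℝ → ℝ)) {A B : Type}
    [MetricSpace A] [MetricSpace B] (e : A ≃ₜ B) : Prop :=
  LocallyGammaCont Γ (⇑e) ∧ LocallyGammaCont Γ (⇑e.symm)

section Urysohn

variable {U : Type} [MetricSpace U]

theorem IsUrysohn.exists_isometry (hU : IsUrysohn U) {ι : Type} [Finite ι] (p q : ι → U)
    (h : ∀ i j, dist (p i) (p j) = dist (q i) (q j)) : ∃ g : U ≃ᵢ U, ∀ i, g (p i) = q i := by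
  classical
  let F : U → U := fun x => if hx : ∃ i, p i = x then q hx.choose else x
  have hF : ∀ i, F (p i) = q i := by
    intro i
    have hx : ∃ j, p j = p i := ⟨i, rfl⟩
    have h1 : F (p i) = q hx.choose := dif_pos hx
    rw [h1, ← dist_eq_zero, ← h, hx.choose_spec, dist_self]
  obtain ⟨g, hg⟩ := hU.2.2.2 (range p) F (finite_range p) (by
    rintro _ ⟨i, rfl⟩ _ ⟨j, rfl⟩
    rw [hF, hF, h])
  exact ⟨g, fun i => (hg _ ⟨i, rfl⟩).trans (hF i)⟩

/-- Every separable metric space embeds with prescribed values on a finite family. -/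
theorem IsUrysohn.exists_embedding (hU : IsUrysohn U) {ι : Type} [Finite ι] {Z : Type}
    [MetricSpace Z] [TopologicalSpace.SeparableSpace Z] (p : ι → Z) (q : ι → U)
    (h : ∀ i j, dist (p i) (p j) = dist (q i) (q j)) :
    ∃ f : Z → U, Isometry f ∧ ∀ i, f (p i) = q i := by
  obtain ⟨e, he⟩ := hU.2.2.1 Z
  obtain ⟨g, hg⟩ := hU.exists_isometry (fun i => e (p i)) q (fun i j => by rw [he.dist_eq, h])
  exact ⟨g ∘ e, g.isometry.comp he, hg⟩

/-- One-point extensions of finite subspaces are realized. -/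
theorem IsUrysohn.exists_dist_eq_s18 (hU : IsUrysohn U) {ι : Type} [Finite ι] (w : ι → U) (f : ι → ℝ)
    (hlip : ∀ i j, f i ≤ f j + dist (w i) (w j)) (htri : ∀ i j, dist (w i) (w j) ≤ f i + f j) :
    ∃ z, ∀ i, dist z (w i) = f i := by
  have := Fintype.ofFinite ι
  let k : ι → ι → ℝ := fun i j => dist (w i) (w j)
  have hk : ∀ i (f : ι → ℝ), (∀ i j, f i ≤ f j + dist (w i) (w j)) →
      (∀ i j, dist (w i) (w j) ≤ f i + f j) → dist f (k i) = f i := by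
    intro i f h1 h2
    apply le_antisymm
    · refine (dist_pi_le_iff (by linarith [h2 i i, dist_self (w i)])).2 fun j => ?_
      rw [Real.dist_eq, abs_le]
      constructor
      · linarith [h2 i j]
      · linarith [h1 j i, dist_comm (w i) (w j)]
    · have := dist_le_pi_dist f (k i) i
      simp only [k, dist_self, Real.dist_eq, sub_zero] at this
      exact (le_abs_self _).trans this
  obtain ⟨e, he, hew⟩ := hU.exists_embedding k w fun i j => by
    rw [hk j (k i) (fun a b => dist_triangle_right _ _ _ |>.trans (by rw [dist_comm (w a) (w b), dist_comm (w b) (w a)]))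
      (fun a b => dist_triangle_left _ _ _)]
  exact ⟨e f, fun i => by rw [← hew, he.dist_eq, hk i f hlip htri]⟩

/-- A finite system of two-sided distance constraints with nonempty feasible region is solvable. -/
theorem IsUrysohn.exists_dist_mem (hU : IsUrysohn U) {ι : Type} [Finite ι] [Nonempty ι]
    (w : ι → U) (l u : ι → ℝ)
    (hu : ∀ i j, dist (w i) (w j) ≤ u i + u j) (hl : ∀ i j, l j ≤ u i + dist (w i) (w j)) :
    ∃ z, ∀ i, l i ≤ dist z (w i) ∧ dist z (w i) ≤ u i := by
  have hbdd : ∀ j, BddBelow (range fun i => u i + dist (w i) (w j)) := fun j =>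
    (finite_range _).bddBelow
  obtain ⟨z, hz⟩ := hU.exists_dist_eq_s18 w (fun j => ⨅ i, (u i + dist (w i) (w j))) (by
      intro i j
      rw [← sub_le_iff_le_add]
      refine le_ciInf fun k => ?_
      have := ciInf_le (hbdd i) k
      linarith [dist_triangle_right (w k) (w i) (w j)]) (by
      intro i j
      rw [← sub_le_iff_le_add]
      refine le_ciInf fun k => ?_
      rw [sub_le_comm]
      refine le_ciInf fun m => ?_
      linarith [hu k m, dist_triangle_left (w i) (w j) (w k), dist_triangle (w k) (w m) (w j)])
  refine ⟨z, fun j => ?_⟩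
  rw [hz]
  refine ⟨le_ciInf fun i => hl i j, (ciInf_le (hbdd j) j).trans (by simp)⟩

end Urysohn

section Moves

variable {U : Type} [MetricSpace U]

/-- A set of pairs that is the graph of an `L`-bi-Lipschitz partial map of `U` preserving the
spheres around `c` and displacing each point by at most half its depth in the ball of radius
`r` around `c`. -/
structure IsPartialMove (c : U) (r L : ℝ) (S : Set (U × U)) : Prop where
  lip : ∀ p ∈ S, ∀ q ∈ S, dist p.2 q.2 ≤ L * dist p.1 q.1
  antilip : ∀ p ∈ S, ∀ q ∈ S, dist p.1 q.1 ≤ L * dist p.2 q.2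
  sphere : ∀ p ∈ S, dist c p.2 = dist c p.1
  disp : ∀ p ∈ S, 2 * dist p.1 p.2 ≤ max 0 (r - dist c p.1)

theorem IsPartialMove.swap {c : U} {r L : ℝ} {S : Set (U × U)} (h : IsPartialMove c r L S) :
    IsPartialMove c r L (Prod.swap ⁻¹' S) where
  lip p hp q hq := h.antilip _ hp _ hq
  antilip p hp q hq := h.lip _ hp _ hq
  sphere p hp := (h.sphere _ hp).symm
  disp p hp := by
    have := h.disp _ hp
    have h2 := h.sphere _ hp
    simp only [Prod.fst_swap, Prod.snd_swap] at this h2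
    rwa [h2, dist_comm]

theorem IsPartialMove.exists_insert (hU : IsUrysohn U) {c : U} {r L : ℝ} (hL : 2 ≤ L)
    {S : Set (U × U)} (h : IsPartialMove c r L S) (hS : S.Finite) (a : U) :
    ∃ b, IsPartialMove c r L (insert (a, b) S) := by
  have := hS.to_subtype
  have hL0 : 0 < L := by linarith
  set ρ : ℝ := max 0 (r - dist c a) with hρ
  have hρ0 : 0 ≤ ρ := le_max_left _ _
  have hρS : ∀ p ∈ S, 2 * dist p.1 p.2 ≤ ρ + dist a p.1 := by
    intro p hp
    refine (h.disp p hp).trans (max_le (by positivity) ?_)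
    linarith [le_max_right 0 (r - dist c a), dist_triangle_right c a p.1]
  have hi : 0 < L⁻¹ := by positivity
  have hi2 : L⁻¹ ≤ 1 / 2 := by
    rw [inv_le_comm₀ hL0 (by norm_num)]; linarith
  have hdiv : ∀ p ∈ S, ∀ q ∈ S, L⁻¹ * dist p.1 q.1 ≤ dist p.2 q.2 := fun p hp q hq => by
    rw [inv_mul_le_iff₀ hL0]; exact h.antilip p hp q hq
  have hmul : ∀ x : ℝ, 0 ≤ x → L⁻¹ * x ≤ 1 / 2 * x := fun x hx =>
    mul_le_mul_of_nonneg_right hi2 hx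
  have hmul2 : ∀ x : ℝ, 0 ≤ x → 2 * x ≤ L * x := fun x hx =>
    mul_le_mul_of_nonneg_right hL hx
  obtain ⟨b, hb⟩ := hU.exists_dist_mem (ι := S ⊕ Bool)
    (Sum.elim (fun p => p.1.2) (fun t => cond t a c))
    (Sum.elim (fun p => L⁻¹ * dist a p.1.1) (fun t => cond t 0 (dist c a)))
    (Sum.elim (fun p => L * dist a p.1.1) (fun t => cond t (ρ / 2) (dist c a))) (by
      rintro (⟨p, hp⟩ | _ | _) (⟨q, hq⟩ | _ | _) <;>
        simp only [Sum.elim_inl, Sum.elim_inr, cond_true, cond_false, dist_self]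
      · rw [← mul_add]
        exact (h.lip p hp q hq).trans
          (mul_le_mul_of_nonneg_left (dist_triangle_left _ _ _) hL0.le)
      · rw [dist_comm, h.sphere p hp]
        linarith [hmul2 _ (dist_nonneg (x := a) (y := p.1)), dist_triangle c a p.1,
          dist_nonneg (x := a) (y := p.1)]
      · linarith [hmul2 _ (dist_nonneg (x := a) (y := p.1)), hρS p hp,
          dist_triangle_left p.2 a p.1, dist_comm a p.1, dist_nonneg (x := a) (y := p.1)]
      · rw [h.sphere q hq]
        linarith [hmul2 _ (dist_nonneg (x := a) (y := q.1)), dist_triangle c a q.1,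
          dist_nonneg (x := a) (y := q.1)]
      · positivity
      · linarith
      · linarith [hmul2 _ (dist_nonneg (x := a) (y := q.1)), hρS q hq,
          dist_triangle a q.1 q.2, dist_nonneg (x := a) (y := q.1)]
      · linarith [dist_comm a c]
      · positivity) (by
      rintro (⟨p, hp⟩ | _ | _) (⟨q, hq⟩ | _ | _) <;>
        simp only [Sum.elim_inl, Sum.elim_inr, cond_true, cond_false, dist_self]
      · have h1 : L⁻¹ * dist a q.1 ≤ L⁻¹ * (dist a p.1 + dist p.1 q.1) :=
          mul_le_mul_of_nonneg_left (dist_triangle _ _ _) hi.le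
        linarith [hdiv p hp q hq, hmul _ (dist_nonneg (x := a) (y := p.1)),
          hmul2 _ (dist_nonneg (x := a) (y := p.1)), dist_nonneg (x := a) (y := p.1)]
      · rw [dist_comm p.2, h.sphere p hp]
        linarith [hmul2 _ (dist_nonneg (x := a) (y := p.1)), dist_triangle_right c a p.1,
          dist_nonneg (x := a) (y := p.1)]
      · positivity
      · rw [h.sphere q hq]
        linarith [hmul _ (dist_nonneg (x := a) (y := q.1)), dist_triangle_left a q.1 c,
          dist_nonneg (x := a) (y := q.1)]
      · linarith
      · positivity
      · linarith [hmul _ (dist_nonneg (x := a) (y := q.1)), hρS q hq,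
          dist_triangle_right a q.1 q.2, dist_nonneg (x := a) (y := q.1)]
      · linarith [dist_comm a c]
      · positivity)
  have hbS : ∀ p ∈ S, L⁻¹ * dist a p.1 ≤ dist b p.2 ∧ dist b p.2 ≤ L * dist a p.1 :=
    fun p hp => hb (Sum.inl ⟨p, hp⟩)
  have hbS' : ∀ p ∈ S, dist a p.1 ≤ L * dist b p.2 := fun p hp => by
    rw [← inv_mul_le_iff₀ hL0]; exact (hbS p hp).1
  have hba : dist b a ≤ ρ / 2 := (hb (Sum.inr true)).2
  have hbc : dist b c = dist c a := le_antisymm (hb (Sum.inr false)).2 (hb (Sum.inr false)).1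
  refine ⟨b, ⟨?_, ?_, ?_, ?_⟩⟩
  · rintro p (rfl | hp) q (rfl | hq)
    · simp
    · exact (hbS q hq).2
    · rw [dist_comm, dist_comm p.1]; exact (hbS p hp).2
    · exact h.lip p hp q hq
  · rintro p (rfl | hp) q (rfl | hq)
    · simp
    · exact hbS' q hq
    · rw [dist_comm, dist_comm p.2]; exact hbS' p hp
    · exact h.antilip p hp q hq
  · rintro p (rfl | hp)
    · rw [dist_comm]; exact hbc
    · exact h.sphere p hp
  · rintro p (rfl | hp)
    · dsimp only; rw [dist_comm]; linarith
    · exact h.disp p hp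

theorem IsPartialMove.exists_insert' (hU : IsUrysohn U) {c : U} {r L : ℝ} (hL : 2 ≤ L)
    {S : Set (U × U)} (h : IsPartialMove c r L S) (hS : S.Finite) (b : U) :
    ∃ a, IsPartialMove c r L (insert (a, b) S) := by
  obtain ⟨a, ha⟩ := h.swap.exists_insert hU hL
    (hS.preimage (Prod.swap_injective.injOn)) b
  refine ⟨a, ?_⟩
  convert ha.swap using 1
  ext ⟨x, y⟩
  simp [and_comm]

theorem IsPartialMove.closure {c : U} {r L : ℝ} {S : Set (U × U)} (h : IsPartialMove c r L S) :
    IsPartialMove c r L (closure S) := by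
  have key : ∀ f g : U × U → U × U → ℝ, Continuous (Function.uncurry f) →
      Continuous (Function.uncurry g) → (∀ p ∈ S, ∀ q ∈ S, f p q ≤ g p q) →
      ∀ p ∈ _root_.closure S, ∀ q ∈ _root_.closure S, f p q ≤ g p q := by
    intro f g hf hg hfg p hp q hq
    have hcl : IsClosed {t : (U × U) × (U × U) | Function.uncurry f t ≤ Function.uncurry g t} :=
      isClosed_le hf hg
    have : (p, q) ∈ _root_.closure (S ×ˢ S) := by rw [closure_prod_eq]; exact ⟨hp, hq⟩
    exact hcl.closure_subset_iff.2 (fun t ht => hfg _ ht.1 _ ht.2) this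
  refine ⟨?_, ?_, ?_, ?_⟩
  · exact key (fun p q => dist p.2 q.2) (fun p q => L * dist p.1 q.1)
      (by simp only [Function.uncurry_def]; fun_prop) (by simp only [Function.uncurry_def]; fun_prop)
      h.lip
  · exact key (fun p q => dist p.1 q.1) (fun p q => L * dist p.2 q.2)
      (by simp only [Function.uncurry_def]; fun_prop) (by simp only [Function.uncurry_def]; fun_prop)
      h.antilip
  · intro p hp
    apply le_antisymm
    · exact key (fun p q => dist c p.2) (fun p q => dist c p.1)
        (by simp only [Function.uncurry_def]; fun_prop)
        (by simp only [Function.uncurry_def]; fun_prop)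
        (fun p hp _ _ => (h.sphere p hp).le) p hp p hp
    · exact key (fun p q => dist c p.1) (fun p q => dist c p.2)
        (by simp only [Function.uncurry_def]; fun_prop)
        (by simp only [Function.uncurry_def]; fun_prop)
        (fun p hp _ _ => (h.sphere p hp).ge) p hp p hp
  · intro p hp
    exact key (fun p q => 2 * dist p.1 p.2) (fun p q => max 0 (r - dist c p.1))
        (by simp only [Function.uncurry_def]; fun_prop)
        (by simp only [Function.uncurry_def]; fun_prop)
        (fun p hp _ _ => h.disp p hp) p hp p hp

theorem IsPartialMove.exists_mem_closure [CompleteSpace U] {c : U} {r L : ℝ} (hL : 0 < L)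
    {S : Set (U × U)} (h : IsPartialMove c r L S) (hd : Dense (Prod.fst '' S)) (a : U) :
    ∃ b, (a, b) ∈ _root_.closure S := by
  obtain ⟨s, hs, hsa⟩ := mem_closure_iff_seq_limit.1 (hd a)
  choose p hpS hp using hs
  have hcau : CauchySeq fun n => (p n).2 := by
    have hc := hsa.cauchySeq
    rw [Metric.cauchySeq_iff] at hc ⊢
    intro ε hε
    obtain ⟨N, hN⟩ := hc (ε / L) (by positivity)
    refine ⟨N, fun m hm n hn => ?_⟩
    have h1 := hN m hm n hn
    rw [← hp, ← hp, lt_div_iff₀ hL] at h1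
    linarith [h.lip _ (hpS m) _ (hpS n)]
  obtain ⟨b, hb⟩ := cauchySeq_tendsto_of_complete hcau
  refine ⟨b, mem_closure_iff_seq_limit.2 ⟨p, hpS, ?_⟩⟩
  have : Filter.Tendsto (fun n => (p n).1) Filter.atTop (nhds a) := by simpa only [hp] using hsa
  simpa using this.prodMk_nhds hb

/-- A bi-Lipschitz bijection of the whole space supported in `O`, with displacements controlled
by the distance to the complement of `O`. -/
structure IsMove (L : ℝ) (O : Set U) (e : U ≃ U) : Prop where
  lip : ∀ z w, dist (e z) (e w) ≤ L * dist z w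
  lip_symm : ∀ z w, dist (e.symm z) (e.symm w) ≤ L * dist z w
  disp : ∀ z, ∀ w ∉ O, 2 * dist z (e z) ≤ dist z w
  disp_symm : ∀ z, ∀ w ∉ O, 2 * dist z (e.symm z) ≤ dist z w

theorem IsPartialMove.exists_equiv (hU : IsUrysohn U) {c : U} {r L : ℝ} (hL : 2 ≤ L)
    {S : Set (U × U)} (h : IsPartialMove c r L S) (hS : S.Finite) :
    ∃ e : U ≃ U, IsMove L (ball c r) e ∧ ∀ p ∈ S, e p.1 = p.2 := by
  classical
  have := hU.1
  have := hU.2.1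
  have : Nonempty U := ⟨c⟩
  have hL0 : 0 < L := by linarith
  let P := {T : Finset (U × U) // IsPartialMove c r L (T : Set (U × U))}
  let d := TopologicalSpace.denseSeq U
  let D : ℕ ⊕ ℕ → Order.Cofinal P := fun i =>
    { carrier := {T | Sum.elim (fun n => ∃ b, (d n, b) ∈ T.1) (fun n => ∃ a, (a, d n) ∈ T.1) i}
      isCofinal := by
        rintro ⟨T, hT⟩
        rcases i with n | n
        · obtain ⟨b, hb⟩ := hT.exists_insert hU hL T.finite_toSet (d n)
          refine ⟨⟨insert (d n, b) T, by simpa using hb⟩, ⟨b, by simp⟩, ?_⟩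
          exact Finset.subset_insert _ _
        · obtain ⟨a, ha⟩ := hT.exists_insert' hU hL T.finite_toSet (d n)
          refine ⟨⟨insert (a, d n) T, by simpa using ha⟩, ⟨a, by simp⟩, ?_⟩
          exact Finset.subset_insert _ _ }
  let p₀ : P := ⟨hS.toFinset, by simpa using h⟩
  let I := Order.idealOfCofinals p₀ D
  let W : Set (U × U) := ⋃ T ∈ I, (T.1 : Set (U × U))
  have hSW : S ⊆ W := fun p hp => mem_biUnion (Order.mem_idealOfCofinals p₀ D) (by simpa [p₀] using hp)
  have hdir : ∀ p ∈ W, ∀ q ∈ W, ∃ T : P, p ∈ T.1 ∧ q ∈ T.1 := by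
    intro p hp q hq
    simp only [W, mem_iUnion] at hp hq
    obtain ⟨T, hT, hp⟩ := hp
    obtain ⟨T', hT', hq⟩ := hq
    obtain ⟨T'', -, h1, h2⟩ := I.directed T hT T' hT'
    exact ⟨T'', h1 hp, h2 hq⟩
  have hW : IsPartialMove c r L W := by
    refine ⟨fun p hp q hq => ?_, fun p hp q hq => ?_, fun p hp => ?_, fun p hp => ?_⟩
    · obtain ⟨T, h1, h2⟩ := hdir p hp q hq
      exact T.2.lip p h1 q h2
    · obtain ⟨T, h1, h2⟩ := hdir p hp q hq
      exact T.2.antilip p h1 q h2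
    · obtain ⟨T, h1, h2⟩ := hdir p hp p hp
      exact T.2.sphere p h1
    · obtain ⟨T, h1, h2⟩ := hdir p hp p hp
      exact T.2.disp p h1
  have hfst : Dense (Prod.fst '' W) := by
    refine (TopologicalSpace.denseRange_denseSeq U).mono ?_
    rintro _ ⟨n, rfl⟩
    obtain ⟨T, ⟨b, hb⟩, hT⟩ := Order.cofinal_meets_idealOfCofinals p₀ D (Sum.inl n)
    exact ⟨_, mem_biUnion hT hb, rfl⟩
  have hsnd : Dense (Prod.fst '' (Prod.swap ⁻¹' W)) := by
    refine (TopologicalSpace.denseRange_denseSeq U).mono ?_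
    rintro _ ⟨n, rfl⟩
    obtain ⟨T, ⟨b, hb⟩, hT⟩ := Order.cofinal_meets_idealOfCofinals p₀ D (Sum.inr n)
    exact ⟨(d n, b), mem_biUnion hT hb, rfl⟩
  have hcl := hW.closure
  choose f hf using hW.exists_mem_closure hL0 hfst
  choose f' hf' using hW.swap.exists_mem_closure hL0 hsnd
  replace hf' : ∀ b, (f' b, b) ∈ _root_.closure W := by
    intro b
    have h1 := map_mem_closure (f := Prod.swap) (t := W) (by fun_prop) (hf' b) (fun p hp => hp)
    exact h1
  have huniq : ∀ a b b', (a, b) ∈ _root_.closure W → (a, b') ∈ _root_.closure W → b = b' := by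
    intro a b b' h1 h2
    have := hcl.lip _ h1 _ h2
    rw [dist_self, mul_zero] at this
    exact dist_le_zero.1 this
  have huniq' : ∀ a a' b, (a, b) ∈ _root_.closure W → (a', b) ∈ _root_.closure W → a = a' := by
    intro a b b' h1 h2
    have := hcl.antilip _ h1 _ h2
    rw [dist_self, mul_zero] at this
    exact dist_le_zero.1 this
  let e : U ≃ U := ⟨f, f', fun a => huniq' _ _ _ (hf' _) (hf _), fun b => huniq _ _ _ (hf _) (hf' _)⟩
  have hρ : ∀ z, ∀ w ∉ ball c r, max 0 (r - dist c z) ≤ dist z w := by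
    intro z w hw
    refine max_le dist_nonneg ?_
    rw [mem_ball, not_lt, dist_comm] at hw
    linarith [dist_triangle c z w]
  refine ⟨e, ⟨fun z w => hcl.lip _ (hf z) _ (hf w), fun z w => hcl.antilip _ (hf' z) _ (hf' w),
    fun z w hw => (hcl.disp _ (hf z)).trans (hρ z w hw), fun z w hw => ?_⟩, fun p hp => ?_⟩
  · have h1 := hcl.disp _ (hf' z)
    have h2 := hcl.sphere _ (hf' z)
    dsimp only at h1 h2
    rw [← h2, dist_comm] at h1
    exact h1.trans (hρ z w hw)
  · exact huniq _ _ _ (hf _) (subset_closure (hSW hp))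

/-- Two points can be moved to two prescribed points at a comparable distance. -/
theorem IsUrysohn.exists_move (hU : IsUrysohn U) {L R : ℝ} (hL : 2 ≤ L) (hR : 0 < R)
    {u v u' v' : U} (h : dist u' v' ≤ L * dist u v) (h' : dist u v ≤ L * dist u' v')
    (h1 : dist u v ≤ R) (h2 : dist u u' ≤ R) (h3 : dist u v' ≤ R) (h4 : dist v u' ≤ R)
    (h5 : dist v v' ≤ R) (h6 : dist u' v' ≤ R) :
    ∃ e : U ≃ U, IsMove L (ball u (4 * R)) e ∧ e u = u' ∧ e v = v' := by
  obtain ⟨c, hc⟩ := hU.exists_dist_eq_s18 ![u, v, u', v'] (fun _ => R)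
    (fun i j => by linarith [dist_nonneg (x := ![u, v, u', v'] i) (y := ![u, v, u', v'] j)])
    (fun i j => by
      fin_cases i <;> fin_cases j <;> simp [dist_comm v u, dist_comm u' u, dist_comm v' u,
        dist_comm u' v, dist_comm v' v, dist_comm v' u'] <;> linarith)
  have hcu : dist c u = R := hc 0
  have hcv : dist c v = R := hc 1
  have hcu' : dist c u' = R := hc 2
  have hcv' : dist c v' = R := hc 3
  obtain ⟨e, he, hS⟩ := IsPartialMove.exists_equiv hU (c := c) (r := 3 * R) (L := L) hL
    (S := {(u, u'), (v, v')}) (by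
      refine ⟨?_, ?_, ?_, ?_⟩
      · rintro p (rfl | rfl) q (rfl | rfl) <;> simp only [dist_self, mul_zero, le_refl]
        · exact h
        · rw [dist_comm, dist_comm v]; exact h
      · rintro p (rfl | rfl) q (rfl | rfl) <;> simp only [dist_self, mul_zero, le_refl]
        · exact h'
        · rw [dist_comm, dist_comm v']; exact h'
      · rintro p (rfl | rfl) <;> dsimp only
        · rw [hcu, hcu']
        · rw [hcv, hcv']
      · rintro p (rfl | rfl) <;> dsimp only
        · rw [hcu]; exact le_max_of_le_right (by linarith)
        · rw [hcv]; exact le_max_of_le_right (by linarith)) (by simp)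
  have hsub : ball c (3 * R) ⊆ ball u (4 * R) := ball_subset_ball' (by linarith)
  exact ⟨e, ⟨he.lip, he.lip_symm, fun z w hw => he.disp z w fun h => hw (hsub h),
    fun z w hw => he.disp_symm z w fun h => hw (hsub h)⟩, hS (u, u') (by simp), hS (v, v') (by simp)⟩

end Moves

open scoped Topology commutatorElement

section AlgebraicDisjointness

variable {G G' : Type*} [Group G] [Group G']

/-- The algebraic disjointness relation of Rubin, Belk, Elliott and Matucci. -/
def AlgDisjoint (f g : G) : Prop :=
  ∀ h, ¬ Commute f h → ∃ f₁ f₂, Commute f₁ g ∧ Commute f₂ g ∧ ⁅f₁, ⁅f₂, h⁆⁆ ≠ 1 ∧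
    Commute ⁅f₁, ⁅f₂, h⁆⁆ g

/-- `h` commutes with the twelfth power of everything algebraically disjoint from `f`. -/
def AlgSubordinate (f h : G) : Prop :=
  ∀ g, AlgDisjoint f g → Commute h (g ^ 12)

theorem AlgDisjoint.map {f g : G} (h : AlgDisjoint f g) (Φ : G ≃* G') :
    AlgDisjoint (Φ f) (Φ g) := by
  intro k hk
  obtain ⟨k, rfl⟩ := Φ.surjective k
  obtain ⟨f₁, f₂, h1, h2, h3, h4⟩ := h k fun hc => hk (hc.map Φ)
  refine ⟨Φ f₁, Φ f₂, h1.map Φ, h2.map Φ, ?_, ?_⟩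
  · rw [← map_commutatorElement, ← map_commutatorElement]
    exact fun h => h3 (Φ.injective (h.trans (map_one Φ).symm))
  · rw [← map_commutatorElement, ← map_commutatorElement]
    exact h4.map Φ

theorem AlgSubordinate.map {f h : G} (hfh : AlgSubordinate f h) (Φ : G ≃* G') :
    AlgSubordinate (Φ f) (Φ h) := by
  intro g hg
  have h1 := hg.map Φ.symm
  rw [Φ.symm_apply_apply] at h1
  have h2 := (hfh _ h1).map Φ
  rwa [map_pow, Φ.apply_symm_apply] at h2

end AlgebraicDisjointness

section Moved

variable {G : Type*} (X : Type*) [Group G] [MulAction G X]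

/-- The set of points moved by a group element. -/
def moved (g : G) : Set X := {x | g • x ≠ x}

variable {X}

theorem mem_moved {g : G} {x : X} : x ∈ moved X g ↔ g • x ≠ x := Iff.rfl

theorem notMem_moved {g : G} {x : X} : x ∉ moved X g ↔ g • x = x := not_not

theorem smul_mem_moved {g : G} {x : X} : g • x ∈ moved X g ↔ x ∈ moved X g := by
  simp [mem_moved]

theorem moved_inv (g : G) : moved X g⁻¹ = moved X g := by
  ext x
  rw [mem_moved, mem_moved, not_iff_not, inv_smul_eq_iff, eq_comm]

theorem mem_moved_conj {g f : G} {x : X} : x ∈ moved X (g * f * g⁻¹) ↔ g⁻¹ • x ∈ moved X f := by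
  rw [mem_moved, mem_moved, not_iff_not, mul_smul, mul_smul, ← eq_inv_smul_iff]

theorem moved_pow_subset (g : G) (n : ℕ) : moved X (g ^ n) ⊆ moved X g := by
  intro x hx hg
  refine hx ?_
  induction n with
  | zero => simp
  | succ n ih =>
    rw [pow_succ, mul_smul, hg]
    by_contra h
    exact h (ih h)

theorem ne_one_of_mem_moved {g : G} {x : X} (h : x ∈ moved X g) : g ≠ 1 := by
  rintro rfl
  exact h (one_smul _ _)

variable [FaithfulSMul G X]

theorem commute_of_disjoint_moved {f g : G} (h : Disjoint (moved X f) (moved X g)) :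
    Commute f g := by
  refine eq_of_smul_eq_smul (α := X) fun x => ?_
  rw [mul_smul, mul_smul]
  by_cases hx : x ∈ moved X f
  · rw [notMem_moved.1 (h.notMem_of_mem_left hx),
      notMem_moved.1 (h.notMem_of_mem_left (smul_mem_moved.2 hx))]
  · by_cases hx' : x ∈ moved X g
    · rw [notMem_moved.1 (h.notMem_of_mem_right hx'),
        notMem_moved.1 (h.notMem_of_mem_right (smul_mem_moved.2 hx'))]
    · rw [notMem_moved.1 hx, notMem_moved.1 hx', notMem_moved.1 hx]

variable (X) in
theorem moved_nonempty {g : G} (h : g ≠ 1) : (moved X g).Nonempty := by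
  by_contra hne
  refine h (eq_of_smul_eq_smul (α := X) fun x => ?_)
  rw [one_smul]
  exact notMem_moved.1 fun hx => hne ⟨x, hx⟩

end Moved

section LocallyMoving

variable {G : Type*} {X : Type*} [Group G] [MulAction G X] [TopologicalSpace X] [T2Space X]

variable (G X) in
/-- Every point can be moved inside every neighbourhood of it. -/
def LocallyMoving : Prop :=
  ∀ (O : Set X), IsOpen O → ∀ x ∈ O, ∃ g : G, moved X g ⊆ O ∧ x ∈ moved X g

theorem LocallyMoving.exists_pow (hG : LocallyMoving G X) {O : Set X} (hO : IsOpen O) {x : X}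
    (hx : x ∈ O) (n : ℕ) :
    ∃ g : G, moved X g ⊆ O ∧ ∀ i, 1 ≤ i → i ≤ n → g ^ i • x ≠ x := by
  induction n with
  | zero => exact ⟨1, fun z hz => absurd (one_smul G z) hz, fun i h1 h2 => by omega⟩
  | succ n ih =>
    obtain ⟨g, hgO, hg⟩ := ih
    by_cases hn : g ^ (n + 1) • x = x
    · let V : Set X := O ∩ ⋂ i ∈ Finset.Icc 1 n, {g ^ i • x}ᶜ
      have hV : IsOpen V := hO.inter
        (isOpen_biInter_finset fun i _ => isOpen_compl_singleton)
      obtain ⟨k, hkV, hk⟩ := hG V hV x ⟨hx, by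
        simp only [mem_iInter, Finset.mem_Icc, mem_compl_iff, mem_singleton_iff]
        exact fun i hi h => hg i hi.1 hi.2 h.symm⟩
      have hfix : ∀ i, 1 ≤ i → i ≤ n → k • g ^ i • x = g ^ i • x := by
        intro i h1 h2
        refine notMem_moved.1 fun h => ?_
        have := (hkV h).2
        simp only [mem_iInter, Finset.mem_Icc, mem_compl_iff, mem_singleton_iff] at this
        exact this i ⟨h1, h2⟩ rfl
      have hpow : ∀ i ≤ n, (k * g) ^ i • x = g ^ i • x := by
        intro i hi
        induction i with
        | zero => simp
        | succ i ih =>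
          rw [pow_succ', mul_smul, ih (by omega), mul_smul, ← mul_smul g, ← pow_succ',
            hfix _ (by omega) hi]
      refine ⟨k * g, ?_, fun i h1 h2 => ?_⟩
      · intro z hz
        by_contra hzO
        refine hz ?_
        rw [mul_smul, notMem_moved.1 fun h => hzO (hgO h), notMem_moved.1 fun h => hzO (hkV h).1]
      · rcases h2.lt_or_eq with h2 | rfl
        · rw [hpow i (by omega)]
          exact hg i h1 (by omega)
        · rw [pow_succ', mul_smul, hpow n le_rfl, mul_smul, ← mul_smul g, ← pow_succ', hn]
          exact hk
    · refine ⟨g, hgO, fun i h1 h2 => ?_⟩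
      rcases h2.lt_or_eq with h2 | rfl
      · exact hg i h1 (by omega)
      · exact hn

variable [ContinuousConstSMul G X]

theorem isOpen_moved (g : G) : IsOpen (moved X g) :=
  isOpen_ne_fun (continuous_const_smul g) continuous_id

theorem exists_isOpen_smul_notMem {g : G} {x : X} (h : x ∈ moved X g) {O : Set X} (hO : IsOpen O)
    (hx : x ∈ O) : ∃ V ⊆ O, IsOpen V ∧ x ∈ V ∧ ∀ z ∈ V, g • z ∉ V := by
  obtain ⟨A, B, hA, hB, hgA, hxB, hAB⟩ := t2_separation h
  refine ⟨O ∩ B ∩ (fun z => g • z) ⁻¹' A, fun z hz => hz.1.1,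
    (hO.inter hB).inter (hA.preimage (continuous_const_smul g)), ⟨⟨hx, hxB⟩, hgA⟩, ?_⟩
  intro z hz hz'
  exact hAB.notMem_of_mem_left hz.2 hz'.1.2

variable [FaithfulSMul G X]

theorem LocallyMoving.algDisjoint (hG : LocallyMoving G X) {f g : G}
    (hfg : Disjoint (moved X f) (moved X g)) : AlgDisjoint f g := by
  intro h hfh
  obtain ⟨x, hxf, hxh⟩ : ∃ x, x ∈ moved X f ∧ x ∈ moved X h := by
    by_contra! hne
    exact hfh (commute_of_disjoint_moved (Set.disjoint_left.2 hne))
  obtain ⟨V, hVf, hV, hxV, hhV⟩ := exists_isOpen_smul_notMem hxh (isOpen_moved f) hxf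
  obtain ⟨f₁, hf₁, hxf₁⟩ := hG V hV x hxV
  obtain ⟨W, hWV, hW, hxW, hf₁W⟩ := exists_isOpen_smul_notMem hxf₁ hV hxV
  obtain ⟨f₂, hf₂, hxf₂⟩ := hG W hW x hxW
  have c1 : Commute f₁ g := commute_of_disjoint_moved (hfg.mono_left (hf₁.trans hVf))
  have c2 : Commute f₂ g := commute_of_disjoint_moved (hfg.mono_left (hf₂.trans (hWV.trans hVf)))
  have c3 : Commute (h * f₂⁻¹ * h⁻¹) f₁⁻¹ := by
    refine commute_of_disjoint_moved (X := X) (Set.disjoint_left.2 fun z hz hz' => ?_)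
    rw [mem_moved_conj, moved_inv] at hz
    rw [moved_inv] at hz'
    have h1 := hhV _ (hWV (hf₂ hz))
    rw [smul_inv_smul] at h1
    exact h1 (hf₁ hz')
  have key : ⁅f₁, ⁅f₂, h⁆⁆ = ⁅f₁, f₂⁆ := by
    have h1 : ⁅f₂, h⁆ = f₂ * (h * f₂⁻¹ * h⁻¹) := by simp only [commutatorElement_def, mul_assoc]
    rw [h1]
    generalize h * f₂⁻¹ * h⁻¹ = k at c3
    calc f₁ * (f₂ * k) * f₁⁻¹ * (f₂ * k)⁻¹ = f₁ * f₂ * (k * f₁⁻¹) * k⁻¹ * f₂⁻¹ := by group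
      _ = ⁅f₁, f₂⁆ := by rw [c3.eq, commutatorElement_def]; group
  refine ⟨f₁, f₂, c1, c2, ?_, ?_⟩
  · rw [key, Ne, commutatorElement_eq_one_iff_mul_comm]
    intro hc
    have h1 : (f₁ * f₂) • x = (f₂ * f₁) • x := by rw [hc]
    rw [mul_smul, mul_smul, notMem_moved.1 fun h => hf₁W x hxW (hf₂ h)] at h1
    exact hxf₂ (smul_left_cancel f₁ h1)
  · rw [key, commutatorElement_def]
    exact ((c1.mul_left c2).mul_left c1.inv_left).mul_left c2.inv_left

theorem LocallyMoving.disjoint_moved_pow (hG : LocallyMoving G X) {f g : G}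
    (hfg : AlgDisjoint f g) : Disjoint (moved X f) (moved X (g ^ 12)) := by
  rw [Set.disjoint_left]
  intro x hxf hxg
  have hpow : ∀ i ∈ ({1, 2, 3, 4} : Finset ℕ), x ∈ moved X (g ^ i) := by
    intro i hi h
    have h12 : i ∣ 12 := by
      simp only [Finset.mem_insert, Finset.mem_singleton] at hi
      rcases hi with rfl | rfl | rfl | rfl <;> decide
    obtain ⟨m, hm⟩ := h12
    refine moved_pow_subset (g ^ i) m ?_ h
    rwa [← pow_mul, ← hm]
  obtain ⟨V₀, -, hV₀, hxV₀, hfV₀⟩ := exists_isOpen_smul_notMem hxf isOpen_univ (mem_univ x)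
  obtain ⟨V₁, hV₁₀, hV₁, hxV₁, h₁⟩ := exists_isOpen_smul_notMem (hpow 1 (by simp)) hV₀ hxV₀
  obtain ⟨V₂, hV₂₁, hV₂, hxV₂, h₂⟩ := exists_isOpen_smul_notMem (hpow 2 (by simp)) hV₁ hxV₁
  obtain ⟨V₃, hV₃₂, hV₃, hxV₃, h₃⟩ := exists_isOpen_smul_notMem (hpow 3 (by simp)) hV₂ hxV₂
  obtain ⟨V, hV₄₃, hV, hxV, h₄⟩ := exists_isOpen_smul_notMem (hpow 4 (by simp)) hV₃ hxV₃
  have hpowV : ∀ i ∈ ({1, 2, 3, 4} : Finset ℕ), ∀ z ∈ V, g ^ i • z ∉ V := by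
    intro i hi z hz hz'
    simp only [Finset.mem_insert, Finset.mem_singleton] at hi
    have hz3 := hV₄₃ hz
    have hz3' := hV₄₃ hz'
    have hz2 := hV₃₂ hz3
    have hz2' := hV₃₂ hz3'
    rcases hi with rfl | rfl | rfl | rfl
    · exact h₁ z (hV₂₁ hz2) (hV₂₁ hz2')
    · exact h₂ z hz2 hz2'
    · exact h₃ z hz3 hz3'
    · exact h₄ z hz hz'
  obtain ⟨h, hhV, hxh⟩ := hG V hV x hxV
  have hVV₀ : V ⊆ V₀ := hV₄₃.trans (hV₃₂.trans (hV₂₁.trans hV₁₀))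
  obtain ⟨f₁, f₂, c1, c2, hne, hc⟩ := hfg h fun hc => by
    have h1 : (f * h) • x = (h * f) • x := by rw [hc.eq]
    rw [mul_smul, mul_smul, notMem_moved.1 fun h' => hfV₀ x hxV₀ (hVV₀ (hhV h'))] at h1
    exact hxh (smul_left_cancel f h1)
  set k := ⁅f₁, ⁅f₂, h⁆⁆ with hk
  let e : Fin 4 → G := ![1, f₁, f₂, f₁ * f₂]
  have he : ∀ j, Commute (e j) g := by
    intro j
    fin_cases j
    · exact Commute.one_left g
    · exact c1
    · exact c2
    · exact c1.mul_left c2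
  have hcover : ∀ z ∈ moved X k, ∃ j, (e j)⁻¹ • z ∈ V := by
    intro z hz
    by_contra! hzV
    have hh : ∀ w ∉ V, h • w = w := fun w hw => notMem_moved.1 fun h' => hw (hhV h')
    have hh' : ∀ w ∉ V, h⁻¹ • w = w := fun w hw => by rw [inv_smul_eq_iff, hh w hw]
    have z0 : z ∉ V := by simpa [e] using hzV 0
    have z1 : f₁⁻¹ • z ∉ V := hzV 1
    have z2 : f₂⁻¹ • z ∉ V := hzV 2
    have z3 : f₂⁻¹ • f₁⁻¹ • z ∉ V := by simpa [e, mul_smul] using hzV 3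
    refine hz ?_
    have : k = f₁ * (f₂ * (h * (f₂⁻¹ * (h⁻¹ * (f₁⁻¹ * (h * (f₂ * (h⁻¹ * f₂⁻¹)))))))) := by
      rw [hk]; simp only [commutatorElement_def]; group
    rw [this]
    simp only [mul_smul]
    rw [hh' _ z2, smul_inv_smul, hh _ z0, hh' _ z1, hh _ z3, smul_inv_smul, smul_inv_smul]
  obtain ⟨z, hz⟩ := moved_nonempty X hne
  have hzi : ∀ i : Fin 5, ∃ j, (e j)⁻¹ • g ^ (i : ℕ) • z ∈ V := by
    intro i
    refine hcover _ ?_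
    rw [mem_moved, ← mul_smul, (hc.pow_right i).eq, mul_smul]
    exact fun h => hz (smul_left_cancel _ h)
  choose j hj using hzi
  obtain ⟨i, i', hne', hij⟩ := Fintype.exists_ne_map_eq_of_card_lt j (by simp)
  wlog hlt : i < i' generalizing i i'
  · exact this i' i hne'.symm hij.symm (lt_of_le_of_ne (not_lt.1 hlt) hne'.symm)
  have hmem := hj i'
  rw [← hij] at hmem
  refine hpowV (i' - i : ℕ) ?_ _ (hj i) ?_
  · have := i'.2
    have : (i : ℕ) < i' := hlt
    simp only [Finset.mem_insert, Finset.mem_singleton]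
    omega
  · rw [← mul_smul, ← ((he (j i)).inv_left.pow_right _).eq, mul_smul, ← mul_smul (g ^ _), ← pow_add,
      Nat.sub_add_cancel hlt.le]
    exact hmem

theorem LocallyMoving.algSubordinate_iff (hG : LocallyMoving G X) {f h : G} :
    AlgSubordinate f h ↔ moved X h ⊆ closure (moved X f) := by
  constructor
  · intro hfh x hx
    by_contra hxf
    obtain ⟨V, hVf, hV, hxV, hhV⟩ :=
      exists_isOpen_smul_notMem hx (isClosed_closure.isOpen_compl (s := closure (moved X f))) hxf
    obtain ⟨g, hgV, hg⟩ := hG.exists_pow hV hxV 12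
    have hc := hfh g (hG.algDisjoint (Set.disjoint_left.2 fun z hz hz' =>
      hVf (hgV hz') (subset_closure hz)))
    have h1 : (h * g ^ 12) • x = (g ^ 12 * h) • x := by rw [hc.eq]
    rw [mul_smul, mul_smul, notMem_moved.1 fun h' =>
      hhV x hxV (hgV (moved_pow_subset g 12 h'))] at h1
    exact hg 12 (by norm_num) le_rfl (smul_left_cancel h h1)
  · intro hsub g hg
    exact commute_of_disjoint_moved
      (((hG.disjoint_moved_pow hg).closure_left (isOpen_moved _)).mono_left hsub)

theorem LocallyMoving.disjoint_moved_iff (hG : LocallyMoving G X) {f g : G} :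
    Disjoint (moved X f) (moved X g) ↔
      ∀ h, AlgSubordinate f h → AlgSubordinate g h → h = 1 := by
  constructor
  · intro hfg h hf hg
    rw [hG.algSubordinate_iff] at hf hg
    by_contra hne
    obtain ⟨x, hx⟩ := moved_nonempty X hne
    obtain ⟨y, hy, hyf⟩ := mem_closure_iff.1 (hf hx) _ (isOpen_moved h) hx
    obtain ⟨z, hz, hzg⟩ := mem_closure_iff.1 (hg hy) _ (isOpen_moved f) hyf
    exact hfg.notMem_of_mem_left hz hzg
  · intro hh
    rw [Set.disjoint_left]
    intro x hf hg
    obtain ⟨h, hsub, hx⟩ := hG _ ((isOpen_moved f).inter (isOpen_moved g)) x ⟨hf, hg⟩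
    exact ne_one_of_mem_moved hx (hh h
      (hG.algSubordinate_iff.2 fun z hz => subset_closure (hsub hz).1)
      (hG.algSubordinate_iff.2 fun z hz => subset_closure (hsub hz).2))

variable {H : Type*} {Y : Type*} [Group H] [MulAction H Y] [TopologicalSpace Y] [T2Space Y]
  [ContinuousConstSMul H Y] [FaithfulSMul H Y]

theorem LocallyMoving.disjoint_moved_map (hG : LocallyMoving G X) (hH : LocallyMoving H Y)
    (Φ : G ≃* H) {f g : G} (hfg : Disjoint (moved X f) (moved X g)) :
    Disjoint (moved Y (Φ f)) (moved Y (Φ g)) := by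
  rw [hH.disjoint_moved_iff]
  intro h hf hg
  have h1 := hf.map Φ.symm
  have h2 := hg.map Φ.symm
  rw [Φ.symm_apply_apply] at h1 h2
  simpa using hG.disjoint_moved_iff.1 hfg _ h1 h2

theorem LocallyMoving.moved_map_subset (hG : LocallyMoving G X) (hH : LocallyMoving H Y)
    (Φ : G ≃* H) {f g : G} (hfg : moved X f ⊆ moved X g) :
    moved Y (Φ f) ⊆ closure (moved Y (Φ g)) :=
  hH.algSubordinate_iff.1 ((hG.algSubordinate_iff.2 (hfg.trans subset_closure)).map Φ)

end LocallyMoving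

open Filter

theorem exists_seq_disjoint_ball {X : Type*} [MetricSpace X] {x : X}
    (hx : ∀ d > 0, ∃ y, y ≠ x ∧ dist y x < d) {ε : ℝ} (hε : 0 < ε) :
    ∃ (c : ℕ → X) (r : ℕ → ℝ), (∀ n, 0 < r n) ∧
      (∀ m n, m ≠ n → Disjoint (ball (c m) (r m)) (ball (c n) (r n))) ∧
      ∀ n, ball (c n) (r n) ⊆ ball x (ε / (n + 1)) := by
  have : Nonempty X := ⟨x⟩
  choose! pick hne hlt using hx
  let c : ℕ → X := fun n => Nat.rec (pick (ε / 2))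
    (fun n y => pick (min (dist y x / 4) (ε / (2 * (n + 2))))) n
  have hsucc : ∀ n, c (n + 1) = pick (min (dist (c n) x / 4) (ε / (2 * (n + 2)))) := fun n => rfl
  have hpos : ∀ n, 0 < dist (c n) x := by
    intro n
    induction n with
    | zero => exact dist_pos.2 (hne _ (by positivity))
    | succ n ih =>
      rw [hsucc]
      exact dist_pos.2 (hne _ (lt_min (by positivity) (by positivity)))
  have hquarter : ∀ n, dist (c (n + 1)) x < dist (c n) x / 4 := by
    intro n
    have := hpos n
    have h := hlt (min (dist (c n) x / 4) (ε / (2 * (n + 2)))) (lt_min (by positivity) (by positivity))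
    rw [← hsucc] at h
    exact h.trans_le (min_le_left _ _)
  have hbound : ∀ n : ℕ, dist (c n) x < ε / (2 * (n + 1)) := by
    intro n
    cases n with
    | zero =>
      have h := hlt (ε / 2) (by positivity)
      simpa [c] using h
    | succ n =>
      have := hpos n
      have h := hlt (min (dist (c n) x / 4) (ε / (2 * (n + 2))))
        (lt_min (by positivity) (by positivity))
      rw [← hsucc] at h
      refine (h.trans_le (min_le_right _ _)).trans_eq ?_
      push_cast
      ring
  have hanti : ∀ m n, m < n → dist (c n) x < dist (c m) x / 4 := by
    intro m n hmn
    induction n, hmn using Nat.le_induction with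
    | base => exact hquarter m
    | succ n hmn ih => linarith [hquarter n, hpos n]
  have hdisj : ∀ m n, m < n →
      Disjoint (ball (c m) (dist (c m) x / 4)) (ball (c n) (dist (c n) x / 4)) := by
    intro m n hmn
    rw [Set.disjoint_left]
    intro z hz hz'
    rw [mem_ball] at hz hz'
    linarith [hanti m n hmn, dist_triangle_left (c m) x z, dist_triangle z (c n) x, hpos m, hpos n]
  refine ⟨c, fun n => dist (c n) x / 4, fun n => by linarith [hpos n], ?_, ?_⟩
  · intro m n hmn
    rcases lt_or_gt_of_ne hmn with h | h
    · exact hdisj m n h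
    · exact (hdisj n m h).symm
  · intro n z hz
    rw [mem_ball] at hz ⊢
    have h1 := hbound n
    have h2 : ε / (n + 1) = 2 * (ε / (2 * (n + 1))) := by field_simp
    rw [h2]
    linarith [dist_triangle z (c n) x, hpos n]

section Rich

variable (G X : Type*) [Group G] [MetricSpace X] [MulAction G X]

/-- The properties of a group action on a metric space which make the space recoverable from
the group. -/
structure IsRich : Prop where
  trans : ∀ x : X, ∀ V ∈ 𝓝 x, ∃ W ∈ 𝓝 x, ∀ y ∈ W, ∃ g : G, moved X g ⊆ V ∧ g • x = y
  discrete : ∀ x : X, ∀ V ∈ 𝓝 x, ∃ δ > 0, ∃ y : ℕ → X, (∀ n, y n ∈ V) ∧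
    ∀ m n, m ≠ n → δ ≤ dist (y m) (y n)
  bad : ∀ (x : X) (s : ℕ → X) (O : ℕ → Set X), Tendsto s atTop (𝓝 x) →
    (∀ n, IsOpen (O n)) → (∀ n, s n ∈ O n) →
    ∃ g : ℕ → G, (∀ n, moved X (g n) ⊆ O n) ∧ ∀ k : G, ∃ n, ∃ z ∈ O n, k • z ≠ g n • z
  glue : ∀ g : ℕ → G, (∀ m n, m ≠ n → Disjoint (moved X (g m)) (moved X (g n))) →
    LocallyFinite (fun n => moved X (g n)) →
    ∃ k : G, (∀ n, ∀ z ∈ moved X (g n), k • z = g n • z) ∧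
      ∀ z, (∀ n, z ∉ moved X (g n)) → k • z = z

variable {G X}

theorem IsRich.exists_ne (hG : IsRich G X) (x : X) (V : Set X) (hV : V ∈ 𝓝 x) :
    ∃ y ∈ V, y ≠ x := by
  obtain ⟨δ, hδ, y, hy, hsep⟩ := hG.discrete x V hV
  by_cases h : y 0 = x
  · refine ⟨y 1, hy 1, fun h1 => ?_⟩
    have := hsep 0 1 (by norm_num)
    rw [h, h1, dist_self] at this
    linarith
  · exact ⟨y 0, hy 0, h⟩

theorem IsRich.locallyMoving (hG : IsRich G X) : LocallyMoving G X := by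
  intro O hO x hx
  obtain ⟨W, hW, h⟩ := hG.trans x O (hO.mem_nhds hx)
  obtain ⟨y, hy, hne⟩ := hG.exists_ne x W hW
  obtain ⟨g, hg, rfl⟩ := h y hy
  exact ⟨g, hg, hne⟩

variable {H Y : Type*} [Group H] [MetricSpace Y] [MulAction H Y]

theorem IsRich.continuous_of_equivariant [ContinuousConstSMul G X] (hH : IsRich H Y)
    (Φ : G ≃* H) (τ : X ≃ Y)
    (hτ : ∀ g : G, ∀ x, τ (g • x) = Φ g • τ x) : Continuous τ := by
  rw [continuous_iff_continuousAt]
  intro x W hW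
  obtain ⟨h, hhW, hxh⟩ := hH.locallyMoving _ isOpen_interior (τ x) (mem_interior_iff_mem_nhds.2 hW)
  have key : ∀ z, z ∈ moved X (Φ.symm h) ↔ τ z ∈ moved Y h := by
    intro z
    rw [mem_moved, mem_moved, not_iff_not, ← τ.injective.eq_iff, hτ, Φ.apply_symm_apply]
  rw [mem_map]
  filter_upwards [(isOpen_moved (Φ.symm h)).mem_nhds ((key x).2 hxh)] with z hz
  exact mem_preimage.2 (interior_subset (hhW ((key z).1 hz)))

/-- `x` and `y` correspond to each other under `Φ` if `Φ` carries some nontrivial elements with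
small support near `x` to elements with small support near `y`. -/
def Corresponds (Φ : G ≃* H) (x : X) (y : Y) : Prop :=
  ∀ V ∈ 𝓝 x, ∀ W ∈ 𝓝 y, ∃ f : G, f ≠ 1 ∧ moved X f ⊆ V ∧ moved Y (Φ f) ⊆ W

theorem Corresponds.symm {Φ : G ≃* H} {x : X} {y : Y} (h : Corresponds Φ x y) :
    Corresponds Φ.symm y x := by
  intro W hW V hV
  obtain ⟨f, hf, h1, h2⟩ := h V hV W hW
  refine ⟨Φ f, fun h => hf (Φ.injective (h.trans (map_one Φ).symm)), h2, ?_⟩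
  rwa [Φ.symm_apply_apply]

variable [ContinuousConstSMul G X] [ContinuousConstSMul H Y]

theorem Corresponds.smul {Φ : G ≃* H} {x : X} {y : Y} (h : Corresponds Φ x y) (g : G) :
    Corresponds Φ (g • x) (Φ g • y) := by
  intro V hV W hW
  obtain ⟨f, hf, h1, h2⟩ := h _ ((continuous_const_smul g).continuousAt.preimage_mem_nhds hV) _
    ((continuous_const_smul (Φ g)).continuousAt.preimage_mem_nhds hW)
  refine ⟨g * f * g⁻¹, fun h => hf ?_, fun z hz => ?_, fun z hz => ?_⟩
  · simpa using h
  · simpa using h1 (mem_moved_conj.1 hz)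
  · rw [map_mul, map_mul, map_inv] at hz
    simpa using h2 (mem_moved_conj.1 hz)

variable [FaithfulSMul G X] [FaithfulSMul H Y]

theorem IsRich.exists_mapClusterPt (hG : IsRich G X) (hH : IsRich H Y) (Φ : G ≃* H) {x : X}
    {f : ℕ → G} (hf : ∀ m n, m ≠ n → Disjoint (moved X (f m)) (moved X (f n)))
    (hfx : ∀ n : ℕ, moved X (f n) ⊆ ball x (1 / (n + 1))) {y : ℕ → Y}
    (hy : ∀ n, y n ∈ moved Y (Φ (f n))) : ∃ y', MapClusterPt y' atTop y := by
  by_contra! hno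
  have hGm := hG.locallyMoving
  have hHm := hH.locallyMoving
  have hpos : ∀ n : ℕ, (0 : ℝ) < 1 / (n + 1) := fun n => by positivity
  have hex : ∀ n : ℕ, ∃ h : H, moved Y h ⊆ moved Y (Φ (f n)) ∩ ball (y n) (1 / (n + 1)) ∧
      y n ∈ moved Y h := fun n =>
    hHm _ ((isOpen_moved _).inter isOpen_ball) _ ⟨hy n, mem_ball_self (hpos n)⟩
  choose h hhW hyh using hex
  have hhdisj : ∀ m n, m ≠ n → Disjoint (moved Y (h m)) (moved Y (h n)) := fun m n hmn =>
    (hGm.disjoint_moved_map hHm Φ (hf m n hmn)).mono (fun z hz => (hhW m hz).1)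
      fun z hz => (hhW n hz).1
  have hcl : ∀ n, moved X (Φ.symm (h n)) ⊆ closure (moved X (f n)) := by
    intro n
    have := hHm.moved_map_subset hGm Φ.symm (fun z hz => (hhW n hz).1 : moved Y (h n) ⊆ _)
    rwa [Φ.symm_apply_apply] at this
  have hne : ∀ n, (moved X (Φ.symm (h n))).Nonempty := by
    refine fun n => moved_nonempty X fun h1 => ne_one_of_mem_moved (hyh n) ?_
    exact Φ.symm.injective (h1.trans (map_one _).symm)
  choose s hs using hne
  have hsx : Tendsto s atTop (𝓝 x) := by
    rw [tendsto_iff_dist_tendsto_zero]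
    refine squeeze_zero (fun _ => dist_nonneg) (fun n => ?_) tendsto_one_div_add_atTop_nhds_zero_nat
    exact closure_ball_subset_closedBall (closure_mono (hfx n) (hcl n (hs n)))
  obtain ⟨g, hgO, hbad⟩ := hG.bad x s (fun n => moved X (Φ.symm (h n))) hsx
    (fun n => isOpen_moved _) hs
  have hkcl : ∀ n, moved Y (Φ (g n)) ⊆ closure (moved Y (h n)) := by
    intro n
    have := hGm.moved_map_subset hHm Φ (hgO n)
    rwa [Φ.apply_symm_apply] at this
  have hkdisj : ∀ m n, m ≠ n → Disjoint (moved Y (Φ (g m))) (moved Y (Φ (g n))) := fun m n hmn =>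
    hGm.disjoint_moved_map hHm Φ ((hHm.disjoint_moved_map hGm Φ.symm (hhdisj m n hmn)).mono
      (hgO m) (hgO n))
  have hlf : LocallyFinite fun n => moved Y (Φ (g n)) := by
    intro y'
    obtain ⟨V, hV, hVy⟩ : ∃ V ∈ 𝓝 y', ¬ ∃ᶠ n in atTop, y n ∈ V := by
      by_contra! hc
      exact hno y' (mapClusterPt_iff_frequently.2 hc)
    obtain ⟨ρ, hρ, hρV⟩ := Metric.mem_nhds_iff.1 hV
    refine ⟨ball y' (ρ / 2), ball_mem_nhds _ (by positivity), ?_⟩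
    have hev : ∀ᶠ n : ℕ in atTop, ¬ (moved Y (Φ (g n)) ∩ ball y' (ρ / 2)).Nonempty := by
      have h1 : ∀ᶠ n : ℕ in atTop, (1 : ℝ) / (n + 1) < ρ / 2 :=
        tendsto_one_div_add_atTop_nhds_zero_nat.eventually (gt_mem_nhds (by positivity))
      filter_upwards [h1, not_frequently.1 hVy] with n hn hyV
      rintro ⟨z, hz, hzy⟩
      have hz' : dist z (y n) ≤ 1 / (n + 1) :=
        closure_ball_subset_closedBall (closure_mono (fun w hw => (hhW n hw).2) (hkcl n hz))
      refine hyV (hρV ?_)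
      rw [mem_ball] at hzy ⊢
      linarith [dist_triangle_left (y n) y' z]
    rw [← Nat.cofinite_eq_atTop, eventually_cofinite] at hev
    simpa using hev
  obtain ⟨k, hk, hk'⟩ := hH.glue (fun n => Φ (g n)) hkdisj hlf
  have hagree : ∀ n, ∀ z ∈ moved Y (h n), k • z = Φ (g n) • z := by
    intro n z hz
    by_cases hzn : z ∈ moved Y (Φ (g n))
    · exact hk n z hzn
    · rw [notMem_moved.1 hzn]
      refine hk' z fun m hm => ?_
      rcases eq_or_ne m n with rfl | hmn
      · exact hzn hm
      · exact ((hhdisj m n hmn).closure_left (isOpen_moved _)).notMem_of_mem_left (hkcl m hm) hz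
  obtain ⟨n, z, hz, hkz⟩ := hbad (Φ.symm k)
  have hdis : Disjoint (moved Y ((Φ (g n))⁻¹ * k)) (moved Y (h n)) := by
    rw [Set.disjoint_right]
    intro w hw
    rw [notMem_moved, mul_smul, hagree n w hw, inv_smul_smul]
  have h3 := notMem_moved.1 ((hHm.disjoint_moved_map hGm Φ.symm hdis).notMem_of_mem_right hz)
  rw [map_mul, map_inv, Φ.symm_apply_apply, mul_smul, inv_smul_eq_iff] at h3
  exact hkz h3

theorem IsRich.exists_corresponds (hG : IsRich G X) (hH : IsRich H Y) (Φ : G ≃* H) (x : X) :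
    ∃ y : Y, Corresponds Φ x y := by
  have hGm := hG.locallyMoving
  have hHm := hH.locallyMoving
  obtain ⟨c, r, hr, hdisj, hcx⟩ := exists_seq_disjoint_ball (x := x) (fun d hd => by
    obtain ⟨y, hy, hne⟩ := hG.exists_ne x _ (ball_mem_nhds x hd)
    exact ⟨y, hne, hy⟩) one_pos
  choose f hf hcf using fun n => hGm (ball (c n) (r n)) isOpen_ball _ (mem_ball_self (hr n))
  have hne : ∀ n, (moved Y (Φ (f n))).Nonempty := fun n => moved_nonempty Y fun h =>
    ne_one_of_mem_moved (hcf n) (Φ.injective (h.trans (map_one Φ).symm))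
  choose y hy using hne
  obtain ⟨y', hy'⟩ := hG.exists_mapClusterPt hH Φ
    (fun m n hmn => (hdisj m n hmn).mono (hf m) (hf n)) (fun n => (hf n).trans (hcx n)) hy
  refine ⟨y', fun V hV W hW => ?_⟩
  obtain ⟨ρ, hρ, hρV⟩ := Metric.mem_nhds_iff.1 hV
  have h1 : ∀ᶠ n : ℕ in atTop, (1 : ℝ) / (n + 1) < ρ :=
    tendsto_one_div_add_atTop_nhds_zero_nat.eventually (gt_mem_nhds hρ)
  obtain ⟨n, hyn, hn⟩ := ((mapClusterPt_iff_frequently.1 hy' _ (interior_mem_nhds.2 hW)).and_eventually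
    h1).exists
  obtain ⟨h, hhO, hyh⟩ := hHm _ ((isOpen_moved (Φ (f n))).inter isOpen_interior) (y n) ⟨hy n, hyn⟩
  refine ⟨Φ.symm h, fun h1 => ne_one_of_mem_moved hyh (Φ.symm.injective (h1.trans (map_one _).symm)),
    fun z hz => hρV ?_, ?_⟩
  · have := hHm.moved_map_subset hGm Φ.symm (fun z hz => (hhO hz).1 : moved Y h ⊆ _) hz
    rw [Φ.symm_apply_apply] at this
    exact (closure_ball_subset_closedBall
      (closure_mono ((hf n).trans (hcx n)) this)).trans_lt hn
  · rw [Φ.apply_symm_apply]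
    exact fun z hz => interior_subset (hhO hz).2

theorem IsRich.corresponds_unique (hG : IsRich G X) (hH : IsRich H Y) (Φ : G ≃* H) {x : X}
    {y y' : Y} (hy : Corresponds Φ x y) (hy' : Corresponds Φ x y') : y = y' := by
  by_contra hne
  have hGm := hG.locallyMoving
  have hHm := hH.locallyMoving
  obtain ⟨A, A', hA, hA', hyA, hyA', hdisj⟩ := t2_separation hne
  obtain ⟨W, hW, htr⟩ := hH.trans y A (hA.mem_nhds hyA)
  obtain ⟨δ, hδ, p, hpW, hsep⟩ := hH.discrete y W hW
  have hcor : ∀ n, Corresponds Φ x (p n) := by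
    intro n
    obtain ⟨h, hhA, hhp⟩ := htr (p n) (hpW n)
    have hfix : Φ.symm h • x = x := by
      by_contra hmv
      obtain ⟨f, hf1, hfX, hfY⟩ := hy' _ ((isOpen_moved (Φ.symm h)).mem_nhds hmv) A'
        (hA'.mem_nhds hyA')
      have := hHm.disjoint_moved_map hGm Φ.symm (hdisj.mono hhA hfY)
      rw [Φ.symm_apply_apply] at this
      obtain ⟨z, hz⟩ := moved_nonempty X hf1
      exact this.notMem_of_mem_right hz (hfX hz)
    have := hy.smul (Φ.symm h)
    rwa [hfix, Φ.apply_symm_apply, hhp] at this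
  choose f hf1 hfX hfY using fun n : ℕ => hcor n (ball x (1 / (n + 1)))
    (ball_mem_nhds x (by positivity)) (ball (p n) (δ / 4)) (ball_mem_nhds _ (by positivity))
  have hfY' : ∀ m n, m ≠ n → Disjoint (moved Y (Φ (f m))) (moved Y (Φ (f n))) := by
    intro m n hmn
    refine (ball_disjoint_ball ?_).mono (hfY m) (hfY n)
    linarith [hsep m n hmn]
  have hne : ∀ n, (moved Y (Φ (f n))).Nonempty := fun n => moved_nonempty Y fun h =>
    hf1 n (Φ.injective (h.trans (map_one Φ).symm))
  choose q hq using hne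
  obtain ⟨z, hz⟩ := hG.exists_mapClusterPt hH Φ (fun m n hmn => by
    simpa using hHm.disjoint_moved_map hGm Φ.symm (hfY' m n hmn)) hfX hq
  have hfr := mapClusterPt_iff_frequently.1 hz _ (ball_mem_nhds z (by positivity : 0 < δ / 4))
  obtain ⟨m, hm⟩ := hfr.exists
  obtain ⟨n, hn, hmn⟩ := (hfr.and_eventually (eventually_gt_atTop m)).exists
  have h1 := hfY m (hq m)
  have h2 := hfY n (hq n)
  rw [mem_ball] at h1 h2 hm hn
  linarith [hsep m n hmn.ne, dist_triangle_left (p m) (p n) (q m), dist_triangle (q m) z (p n),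
    dist_triangle_left z (p n) (q n)]

theorem IsRich.exists_homeomorph (hG : IsRich G X) (hH : IsRich H Y) (Φ : G ≃* H) :
    ∃ τ : X ≃ₜ Y, ∀ (g : G) (x : X), τ (g • x) = Φ g • τ x := by
  choose τ hτ using hG.exists_corresponds hH Φ
  choose σ hσ using hH.exists_corresponds hG Φ.symm
  let e : X ≃ Y :=
    { toFun := τ
      invFun := σ
      left_inv := fun x => hH.corresponds_unique hG Φ.symm (hσ (τ x)) (hτ x).symm
      right_inv := fun y => hG.corresponds_unique hH Φ (hτ (σ y)) (hσ y).symm }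
  have he : ∀ (g : G) (x : X), e (g • x) = Φ g • e x := fun g x =>
    hG.corresponds_unique hH Φ (hτ (g • x)) ((hτ x).smul g)
  have he' : ∀ (h : H) (y : Y), e.symm (h • y) = Φ.symm h • e.symm y := fun h y =>
    hH.corresponds_unique hG Φ.symm (hσ (h • y)) ((hσ y).smul h)
  exact ⟨⟨e, hH.continuous_of_equivariant Φ e he,
    hG.continuous_of_equivariant Φ.symm e.symm he'⟩, he⟩

end Rich

section Moduli

variable {Γ : Set (ℝ → ℝ)} {α : ℝ → ℝ}

theorem IsModulus.monotoneOn (hα : IsModulus α) : MonotoneOn α (Ici 0) := hα.2.1.monotoneOn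

theorem IsModulus.le_of_le (hα : IsModulus α) {s t : ℝ} (hs : 0 ≤ s) (hst : s ≤ t) : α s ≤ α t :=
  hα.monotoneOn hs (hs.trans hst) hst

theorem IsModulus.exists_lt (hα : IsModulus α) {ε : ℝ} (hε : 0 < ε) :
    ∃ δ > 0, ∀ t, 0 ≤ t → t ≤ δ → α t < ε := by
  obtain ⟨δ, hδ, h⟩ := hα.2.2.2.1 (show (0 : ℝ) ≤ ε / 2 by positivity)
  rw [mem_Ici] at hδ
  refine ⟨δ, hδ.lt_of_ne ?_, fun t h0 ht => ?_⟩
  · rintro rfl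
    rw [hα.1] at h
    linarith
  · linarith [hα.le_of_le h0 ht]

theorem isModulus_const_mul {c : ℝ} (hc : 0 < c) : IsModulus fun x => c * x := by
  refine ⟨by simp, fun x _ y _ h => mul_lt_mul_of_pos_left h hc, fun x hx => mul_nonneg hc.le hx,
    fun y hy => ⟨y / c, div_nonneg hy hc.le, by field_simp⟩, convex_Ici 0, ?_⟩
  intro x _ y _ a b _ _ _
  simp only [smul_eq_mul]
  linarith

theorem IsMCSemigroup.const_mul_mem (hΓ : IsMCSemigroup Γ) {c : ℝ} (hc : 0 < c) :
    (fun x => c * x) ∈ Γ := by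
  have hpow : ∀ n : ℕ, (fun x : ℝ => 2 ^ (n + 1) * x) ∈ Γ := by
    intro n
    induction n with
    | zero => simpa using hΓ.2.1
    | succ n ih =>
      convert hΓ.2.2.1 _ hΓ.2.1 _ ih using 1
      ext x
      simp only [Function.comp_apply]
      ring
  obtain ⟨n, hn⟩ := pow_unbounded_of_one_lt c (one_lt_two)
  refine hΓ.2.2.2 _ (hpow n) _ (isModulus_const_mul hc) ⟨1, one_pos, fun x hx => ?_⟩
  refine mul_le_mul_of_nonneg_right ?_ hx.1
  rw [pow_succ]
  linarith

theorem MCCountablyGenerated.exists_seq (hΓ : IsMCSemigroup Γ) (hΓc : MCCountablyGenerated Γ) :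
    ∃ β : ℕ → ℝ → ℝ, (∀ n, β n ∈ Γ) ∧
      ∀ α ∈ Γ, ∃ a > 0, ∀ N, ∃ n ≥ N, ∀ x ∈ Icc 0 a, α x ≤ β n x := by
  obtain ⟨Γ₀, hsub, hcount, hdom⟩ := hΓc
  obtain ⟨β₀, hβ₀, -⟩ := hdom _ hΓ.2.1
  obtain ⟨e, he⟩ := hcount.exists_eq_range ⟨β₀, hβ₀⟩
  refine ⟨fun n => e n.unpair.1, fun n => hsub (he ▸ mem_range_self _), fun α hα => ?_⟩
  obtain ⟨β, hβ, a, ha, hle⟩ := hdom α hα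
  rw [he] at hβ
  obtain ⟨i, rfl⟩ := hβ
  refine ⟨a, ha, fun N => ⟨Nat.pair i N, Nat.right_le_pair i N, ?_⟩⟩
  simpa only [Nat.unpair_pair] using hle

variable {A B C : Type} [MetricSpace A] [MetricSpace B] [MetricSpace C]

theorem LocallyGammaCont.of_lipschitz (hΓ : IsMCSemigroup Γ) {f : A → B} {L : ℝ} (hL : 0 < L)
    (hf : ∀ u v, dist (f u) (f v) ≤ L * dist u v) : LocallyGammaCont Γ f := fun _ =>
  ⟨1, one_pos, _, hΓ.const_mul_mem hL, fun u v _ _ => hf u v⟩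

/-- `f` is `α`-continuous near `x` for some `α ∈ Γ`. -/
def GammaContAt (Γ : Set (ℝ → ℝ)) (f : A → B) (x : A) : Prop :=
  ∃ ε : ℝ, 0 < ε ∧ ∃ α ∈ Γ,
    ∀ u v : A, dist u x < ε → dist v x < ε → dist (f u) (f v) ≤ α (dist u v)

theorem GammaContAt.comp (hΓ : IsMCSemigroup Γ) {g : B → C} {f : A → B} {x : A}
    (hg : GammaContAt Γ g (f x)) (hf : GammaContAt Γ f x) (hc : ContinuousAt f x) :
    GammaContAt Γ (g ∘ f) x := by
  obtain ⟨ε, hε, α, hα, h⟩ := hf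
  obtain ⟨ε', hε', α', hα', h'⟩ := hg
  obtain ⟨δ, hδ, hball⟩ := Metric.continuousAt_iff.1 hc ε' hε'
  refine ⟨min ε δ, lt_min hε hδ, _, hΓ.2.2.1 _ hα' _ hα, fun u v hu hv => ?_⟩
  rw [lt_min_iff] at hu hv
  exact (h' _ _ (hball hu.2) (hball hv.2)).trans
    ((hΓ.1 _ hα').le_of_le dist_nonneg (h u v hu.1 hv.1))

theorem LocallyGammaCont.comp (hΓ : IsMCSemigroup Γ) {g : B → C} {f : A → B}
    (hg : LocallyGammaCont Γ g) (hf : LocallyGammaCont Γ f) (hc : Continuous f) :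
    LocallyGammaCont Γ (g ∘ f) := fun x =>
  GammaContAt.comp hΓ (hg (f x)) (hf x) hc.continuousAt

theorem LocallyGammaCont.of_eventuallyEq {f : A → B}
    (h : ∀ x, ∃ g : A → B, LocallyGammaCont Γ g ∧ f =ᶠ[𝓝 x] g) : LocallyGammaCont Γ f := by
  intro x
  obtain ⟨g, hg, hfg⟩ := h x
  obtain ⟨ε, hε, α, hα, h⟩ := hg x
  obtain ⟨δ, hδ, hball⟩ := Metric.eventually_nhds_iff.1 hfg
  refine ⟨min ε δ, lt_min hε hδ, α, hα, fun u v hu hv => ?_⟩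
  rw [lt_min_iff] at hu hv
  rw [hball hu.2, hball hv.2]
  exact h u v hu.1 hv.1

theorem LocallyGammaCont.exists_dist_le {β : ℕ → ℝ → ℝ}
    (hβ : ∀ α ∈ Γ, ∃ a > 0, ∀ N, ∃ n ≥ N, ∀ x ∈ Icc 0 a, α x ≤ β n x) {f : A → B}
    (hf : LocallyGammaCont Γ f) {x : A} {u v : ℕ → A} (hu : Tendsto u atTop (𝓝 x))
    (hv : Tendsto v atTop (𝓝 x)) : ∃ n, dist (f (u n)) (f (v n)) ≤ β n (dist (u n) (v n)) := by
  obtain ⟨ε, hε, α, hα, h⟩ := hf x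
  obtain ⟨a, ha, hdom⟩ := hβ α hα
  have huv : Tendsto (fun n => dist (u n) (v n)) atTop (𝓝 0) := by
    simpa using hu.dist hv
  obtain ⟨N, hN⟩ := eventually_atTop.1 (((hu.eventually (ball_mem_nhds x hε)).and
    (hv.eventually (ball_mem_nhds x hε))).and (huv.eventually (gt_mem_nhds ha)))
  obtain ⟨n, hn, hle⟩ := hdom N
  obtain ⟨⟨h1, h2⟩, h3⟩ := hN n hn
  exact ⟨n, (h _ _ h1 h2).trans (hle _ ⟨dist_nonneg, h3.le⟩)⟩

/-- The group of locally `Γ`-bicontinuous auto-homeomorphisms. -/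
def lcGroup (hΓ : IsMCSemigroup Γ) (A : Type) [MetricSpace A] : Subgroup (A ≃ₜ A) where
  carrier := {g | LocallyGammaBicont Γ g}
  mul_mem' := fun {g h} hg hh =>
    ⟨hg.1.comp hΓ hh.1 h.continuous, hh.2.comp hΓ hg.2 g.symm.continuous⟩
  one_mem' := ⟨.of_lipschitz hΓ one_pos fun u v => (one_mul (dist u v)).ge,
    .of_lipschitz hΓ one_pos fun u v => (one_mul (dist u v)).ge⟩
  inv_mem' := fun hg => ⟨hg.2, hg.1⟩

instance (hΓ : IsMCSemigroup Γ) : MulAction (lcGroup hΓ A) A where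
  smul g x := g.1 x
  one_smul _ := rfl
  mul_smul _ _ _ := rfl

theorem lcGroup_smul_def (hΓ : IsMCSemigroup Γ) (g : lcGroup hΓ A) (x : A) : g • x = g.1 x := rfl

instance (hΓ : IsMCSemigroup Γ) : ContinuousConstSMul (lcGroup hΓ A) A where
  continuous_const_smul g := g.1.continuous

instance (hΓ : IsMCSemigroup Γ) : FaithfulSMul (lcGroup hΓ A) A where
  eq_of_smul_eq_smul h := Subtype.ext (Homeomorph.ext h)

/-- Both the homeomorphism and its inverse are Lipschitz. -/
def IsBiLipschitz (g : A ≃ₜ A) : Prop :=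
  ∃ L > 0, (∀ u v, dist (g u) (g v) ≤ L * dist u v) ∧
    ∀ u v, dist (g.symm u) (g.symm v) ≤ L * dist u v

theorem IsBiLipschitz.mem_lcGroup (hΓ : IsMCSemigroup Γ) {g : A ≃ₜ A} (hg : IsBiLipschitz g) :
    g ∈ lcGroup hΓ A := by
  obtain ⟨L, hL, h1, h2⟩ := hg
  exact ⟨.of_lipschitz hΓ hL h1, .of_lipschitz hΓ hL h2⟩

theorem IsBiLipschitz.symm {g : A ≃ₜ A} (hg : IsBiLipschitz g) : IsBiLipschitz g.symm := by
  obtain ⟨L, hL, h1, h2⟩ := hg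
  exact ⟨L, hL, h2, h1⟩

end Moduli

section Glue

theorem exists_perm_glue {X : Type*} (e : ℕ → Equiv.Perm X) (O : ℕ → Set X)
    (hO : ∀ m n, m ≠ n → Disjoint (O m) (O n)) (he : ∀ n, ∀ z ∉ O n, e n z = z) :
    ∃ k : Equiv.Perm X, (∀ n, ∀ z ∈ O n, k z = e n z) ∧ (∀ z, (∀ n, z ∉ O n) → k z = z) ∧
      (∀ n, ∀ z ∈ O n, k.symm z = (e n).symm z) ∧ ∀ z, (∀ n, z ∉ O n) → k.symm z = z := by
  classical
  let K : (ℕ → Equiv.Perm X) → X → X := fun e z =>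
    if h : ∃ n, z ∈ O n then e h.choose z else z
  have hK : ∀ e n, ∀ z ∈ O n, K e z = e n z := by
    intro e n z hz
    have h : ∃ n, z ∈ O n := ⟨n, hz⟩
    have hn : h.choose = n := by
      by_contra hne
      exact (hO _ _ hne).notMem_of_mem_left h.choose_spec hz
    simp only [K, dif_pos h, hn]
  have hK' : ∀ e z, (∀ n, z ∉ O n) → K e z = z := by
    intro e z hz
    simp only [K, dif_neg (not_exists.2 hz)]
  have hmem : ∀ n, ∀ z ∈ O n, e n z ∈ O n := by
    intro n z hz
    by_contra h
    have h1 := (e n).injective (he n _ h)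
    rw [h1] at h
    exact h hz
  have hmem' : ∀ n, ∀ z ∈ O n, (e n).symm z ∈ O n := by
    intro n z hz
    by_contra h
    have h1 := he n _ h
    rw [Equiv.apply_symm_apply] at h1
    rw [← h1] at h
    exact h hz
  let e' : ℕ → Equiv.Perm X := fun n => (e n).symm
  have he' : ∀ n z, e' n z = (e n).symm z := fun n z => rfl
  refine ⟨⟨K e, K e', fun z => ?_, fun z => ?_⟩, hK e, hK' e, hK e', hK' e'⟩
  · by_cases h : ∃ n, z ∈ O n
    · obtain ⟨n, hn⟩ := h
      rw [hK e n z hn, hK e' n _ (hmem n z hn), he', Equiv.symm_apply_apply]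
    · rw [hK' e z (not_exists.1 h), hK' e' z (not_exists.1 h)]
  · by_cases h : ∃ n, z ∈ O n
    · obtain ⟨n, hn⟩ := h
      rw [hK e' n z hn, he', hK e n _ (hmem' n z hn), Equiv.apply_symm_apply]
    · rw [hK' e' z (not_exists.1 h), hK' e z (not_exists.1 h)]

theorem exists_finset_glue {G X : Type*} [Group G] [MulAction G X] (g : ℕ → G)
    (hg : ∀ m n, m ≠ n → Disjoint (moved X (g m)) (moved X (g n))) (F : Finset ℕ) :
    ∃ k : G, (∀ n ∈ F, ∀ z ∈ moved X (g n), k • z = g n • z) ∧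
      ∀ z, (∀ n ∈ F, z ∉ moved X (g n)) → k • z = z := by
  induction F using Finset.induction_on with
  | empty => exact ⟨1, by simp, by simp⟩
  | insert a F ha ih =>
    obtain ⟨k, hk, hk'⟩ := ih
    refine ⟨g a * k, fun n hn z hz => ?_, fun z hz => ?_⟩
    · rw [mul_smul]
      rcases Finset.mem_insert.1 hn with rfl | hn
      · rw [hk' z fun m hm hzm => ?_]
        have hne : m ≠ n := by
          rintro rfl
          exact ha hm
        exact (hg m n hne).notMem_of_mem_left hzm hz
      · rw [hk n hn z hz]
        refine notMem_moved.1 ((hg n a ?_).notMem_of_mem_left (smul_mem_moved.2 hz))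
        exact fun hna => ha (hna ▸ hn)
    · rw [mul_smul, hk' z fun n hn => hz n (Finset.mem_insert_of_mem hn)]
      exact notMem_moved.1 (hz a (Finset.mem_insert_self a F))

variable {Γ : Set (ℝ → ℝ)} {A : Type} [MetricSpace A]

theorem lcGroup_glue_local (hΓ : IsMCSemigroup Γ) (g : ℕ → lcGroup hΓ A)
    (hg : ∀ m n, m ≠ n → Disjoint (moved A (g m)) (moved A (g n)))
    (hlf : LocallyFinite fun n => moved A (g n)) {k : A → A}
    (hk : ∀ n, ∀ z ∈ moved A (g n), k z = g n • z) (hk' : ∀ z, (∀ n, z ∉ moved A (g n)) → k z = z)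
    (x : A) : ∃ p : lcGroup hΓ A, k =ᶠ[𝓝 x] p.1 := by
  obtain ⟨N, hN, hfin⟩ := hlf x
  obtain ⟨p, hp, hp'⟩ := exists_finset_glue g hg hfin.toFinset
  refine ⟨p, ?_⟩
  filter_upwards [hN] with z hz
  rw [← lcGroup_smul_def]
  by_cases h : ∃ n, z ∈ moved A (g n)
  · obtain ⟨n, hn⟩ := h
    rw [hk n z hn, hp n (hfin.mem_toFinset.2 ⟨z, hn, hz⟩) z hn]
  · rw [not_exists] at h
    rw [hk' z h, hp' z fun n _ => h n]

theorem lcGroup_exists_glue (hΓ : IsMCSemigroup Γ) (g : ℕ → lcGroup hΓ A)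
    (hg : ∀ m n, m ≠ n → Disjoint (moved A (g m)) (moved A (g n)))
    (hlf : LocallyFinite fun n => moved A (g n)) :
    ∃ k : lcGroup hΓ A, (∀ n, ∀ z ∈ moved A (g n), k • z = g n • z) ∧
      ∀ z, (∀ n, z ∉ moved A (g n)) → k • z = z := by
  obtain ⟨k, h1, h2, h3, h4⟩ := exists_perm_glue (fun n => (g n).1.toEquiv)
    (fun n => moved A (g n)) hg fun n z hz => notMem_moved.1 hz
  have hl := lcGroup_glue_local hΓ g hg hlf h1 h2
  have hl' := lcGroup_glue_local hΓ (fun n => (g n)⁻¹) (by simpa only [moved_inv] using hg)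
    (by simpa only [moved_inv] using hlf) (k := k.symm) (by simp only [moved_inv]; exact h3)
    (by simpa only [moved_inv] using h4)
  have hcont : ∀ f : A → A, (∀ x, ∃ p : lcGroup hΓ A, f =ᶠ[𝓝 x] p.1) → Continuous f := by
    intro f hf
    rw [continuous_iff_continuousAt]
    intro x
    obtain ⟨p, hp⟩ := hf x
    exact p.1.continuous.continuousAt.congr hp.symm
  refine ⟨⟨⟨k, hcont _ hl, hcont _ hl'⟩, ?_, ?_⟩, h1, h2⟩
  · refine .of_eventuallyEq fun x => ?_
    obtain ⟨p, hp⟩ := hl x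
    exact ⟨p.1, p.2.1, hp⟩
  · refine .of_eventuallyEq fun x => ?_
    obtain ⟨p, hp⟩ := hl' x
    exact ⟨p.1, p.2.1, hp⟩

end Glue

section Restrict

variable {U : Type} [MetricSpace U]

theorem IsMove.apply_eq_self {L : ℝ} {O : Set U} {e : U ≃ U} (he : IsMove L O e) {z : U}
    (hz : z ∉ O) : e z = z := by
  have h := he.disp z z hz
  rw [dist_self] at h
  exact (dist_le_zero.1 (by linarith)).symm

theorem exists_isBiLipschitz_restrict {X : Set U} {L : ℝ} (hL : 0 < L) (e : U ≃ U)
    (h1 : ∀ z w, dist (e z) (e w) ≤ L * dist z w)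
    (h2 : ∀ z w, dist (e.symm z) (e.symm w) ≤ L * dist z w) (hX : ∀ z ∉ X, e z = z) :
    ∃ g : X ≃ₜ X, IsBiLipschitz g ∧ ∀ z : X, (g z : U) = e z := by
  have hiff : ∀ z, z ∈ X ↔ e z ∈ X := by
    intro z
    constructor
    · intro hz
      by_contra h
      have h3 := e.injective (hX _ h)
      rw [h3] at h
      exact h hz
    · intro hz
      by_contra h
      rw [hX z h] at hz
      exact h hz
  have hc : ∀ f : U → U, (∀ z w, dist (f z) (f w) ≤ L * dist z w) → Continuous f := fun f hf =>
    (LipschitzWith.of_dist_le_mul (K := ⟨L, hL.le⟩) hf).continuous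
  let E : U ≃ₜ U := ⟨e, hc _ h1, hc _ h2⟩
  exact ⟨E.subtype hiff, ⟨L, hL, fun u v => h1 u v, fun u v => h2 u v⟩, fun z => rfl⟩

theorem IsUrysohn.exists_isBiLipschitz (hU : IsUrysohn U) {X : Set U} {L R : ℝ} (hL : 2 ≤ L)
    (hR : 0 < R) {u v u' v' : X} (hX : ball (u : U) (4 * R) ⊆ X)
    (h : dist u' v' ≤ L * dist u v) (h' : dist u v ≤ L * dist u' v') (h1 : dist u v ≤ R)
    (h2 : dist u u' ≤ R) (h3 : dist u v' ≤ R) (h4 : dist v u' ≤ R) (h5 : dist v v' ≤ R)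
    (h6 : dist u' v' ≤ R) :
    ∃ g : X ≃ₜ X, IsBiLipschitz g ∧ (∀ z ∉ ball u (4 * R), g z = z) ∧ g u = u' ∧ g v = v' := by
  obtain ⟨e, he, hu, hv⟩ := hU.exists_move hL hR h h' h1 h2 h3 h4 h5 h6
  obtain ⟨g, hg, hge⟩ := exists_isBiLipschitz_restrict (by linarith) e he.lip he.lip_symm
    fun z hz => he.apply_eq_self fun hz' => hz (hX hz')
  refine ⟨g, hg, fun z hz => Subtype.ext ?_, Subtype.ext ?_, Subtype.ext ?_⟩
  · rw [hge]
    exact he.apply_eq_self hz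
  · rw [hge, hu]
  · rw [hge, hv]

theorem exists_ball_subset_nhds {X : Set U} (hX : IsOpen X) (x : X) {V : Set X} (hV : V ∈ 𝓝 x) :
    ∃ R > 0, ball (x : U) (4 * R) ⊆ X ∧ ball x (4 * R) ⊆ V := by
  obtain ⟨ε, hε, h⟩ := Metric.isOpen_iff.1 hX x x.2
  obtain ⟨ε', hε', h'⟩ := Metric.mem_nhds_iff.1 hV
  refine ⟨min ε ε' / 4, by positivity, ?_, ?_⟩
  · rw [mul_div_cancel₀ _ (by norm_num)]
    exact (ball_subset_ball (min_le_left _ _)).trans h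
  · rw [mul_div_cancel₀ _ (by norm_num)]
    exact (ball_subset_ball (min_le_right _ _)).trans h'

theorem IsUrysohn.exists_isBiLipschitz_apply_eq (hU : IsUrysohn U) {X : Set U} {R : ℝ}
    (hR : 0 < R) {x y : X} (hX : ball (x : U) (4 * R) ⊆ X) (hxy : dist x y ≤ R) :
    ∃ g : X ≃ₜ X, IsBiLipschitz g ∧ (∀ z ∉ ball x (4 * R), g z = z) ∧ g x = y := by
  obtain ⟨g, hg, hfix, h, -⟩ := hU.exists_isBiLipschitz le_rfl hR hX (u := x) (v := x) (u' := y)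
    (v' := y) (by simp) (by simp) (by simpa using hR.le) hxy hxy hxy hxy (by simpa using hR.le)
  exact ⟨g, hg, hfix, h⟩

theorem IsUrysohn.exists_geodesic (hU : IsUrysohn U) (a b : U) :
    ∃ γ : ℝ → U, Isometry γ ∧ γ 0 = a ∧ γ (dist a b) = b := by
  obtain ⟨γ, hγ, h⟩ := hU.exists_embedding ![(0 : ℝ), dist a b] ![a, b] (by
    intro i j
    fin_cases i <;> fin_cases j <;> simp [dist_comm, abs_of_nonneg])
  exact ⟨γ, hγ, h 0, h 1⟩

theorem IsUrysohn.exists_line (hU : IsUrysohn U) (a : U) : ∃ γ : ℝ → U, Isometry γ ∧ γ 0 = a := by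
  obtain ⟨γ, hγ, h, -⟩ := hU.exists_geodesic a a
  exact ⟨γ, hγ, h⟩

theorem IsUrysohn.exists_equidistant (hU : IsUrysohn U) (a : U) {δ : ℝ} (hδ : 0 < δ) :
    ∃ y : ℕ → U, y 0 = a ∧ ∀ m n, m ≠ n → dist (y m) (y n) = δ := by
  let M : MetricSpace ℕ :=
    { dist := fun m n => if m = n then 0 else δ
      dist_self := fun m => if_pos rfl
      dist_comm := fun m n => by simp only [eq_comm]
      dist_triangle := fun a b c => by
        by_cases h1 : a = b
        · simp [h1]
        · by_cases h2 : a = c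
          · simp only [if_pos h2, if_neg h1]
            split_ifs <;> linarith
          · simp only [if_neg h2, if_neg h1]
            split_ifs <;> linarith
      eq_of_dist_eq_zero := fun {m n} h => by
        by_contra hne
        exact hδ.ne' ((if_neg hne).symm.trans h) }
  obtain ⟨y, hy, h0⟩ := hU.exists_embedding (ι := Unit) (fun _ => (0 : ℕ)) (fun _ => a)
    (fun _ _ => by simp)
  exact ⟨y, h0 (), fun m n hmn => (hy.dist_eq m n).trans (if_neg hmn)⟩

theorem IsUrysohn.exists_expanding (hU : IsUrysohn U) {X : Set U} (hX : IsOpen X) {β : ℝ → ℝ}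
    (hβ : IsModulus β) (s : X) {O : Set X} (hO : O ∈ 𝓝 s) {η : ℝ} (hη : 0 < η) :
    ∃ g : X ≃ₜ X, IsBiLipschitz g ∧ (∀ z ∉ O, g z = z) ∧ ∃ v ∈ O, dist s v ≤ η ∧
      β (dist s v) < dist (g s) (g v) := by
  obtain ⟨R, hR, hRX, hRO⟩ := exists_ball_subset_nhds hX s hO
  obtain ⟨δ, hδ, hlt⟩ := hβ.exists_lt (show 0 < R / 2 by positivity)
  obtain ⟨γ, hγ, h0⟩ := hU.exists_line (s : U)
  set t : ℝ := min (min δ η) (R / 2) with ht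
  have ht0 : 0 < t := by positivity
  have htR : t ≤ R / 2 := min_le_right _ _
  have htδ : t ≤ δ := (min_le_left _ _).trans (min_le_left _ _)
  have htη : t ≤ η := (min_le_left _ _).trans (min_le_right _ _)
  have hd : ∀ r, 0 ≤ r → dist (s : U) (γ r) = r := by
    intro r hr
    rw [← h0, hγ.dist_eq, Real.dist_eq, zero_sub, abs_neg, abs_of_nonneg hr]
  have hmem : ∀ r, 0 ≤ r → r ≤ R / 2 → γ r ∈ ball (s : U) (4 * R) := by
    intro r hr hr'
    rw [mem_ball, dist_comm, hd r hr]
    linarith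
  let v : X := ⟨γ t, hRX (hmem t ht0.le htR)⟩
  let v' : X := ⟨γ (R / 2), hRX (hmem _ (by positivity) le_rfl)⟩
  have hsv : dist s v = t := hd t ht0.le
  have hsv' : dist s v' = R / 2 := hd _ (by positivity)
  have hvv' : dist v v' = R / 2 - t := by
    change dist (γ t) (γ (R / 2)) = _
    rw [hγ.dist_eq, Real.dist_eq, abs_sub_comm, abs_of_nonneg (by linarith)]
  obtain ⟨g, hg, hfix, hs, hv⟩ := hU.exists_isBiLipschitz (le_max_left 2 (R / 2 / t)) hR hRX
    (u := s) (v := v) (u' := s) (v' := v')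
    (by
      rw [hsv, hsv']
      calc R / 2 = R / 2 / t * t := by field_simp
        _ ≤ _ := by gcongr; exact le_max_right _ _)
    (by
      rw [hsv, hsv']
      have := le_max_left 2 (R / 2 / t)
      nlinarith)
    (by rw [hsv]; linarith) (by simpa using hR.le) (by rw [hsv']; linarith)
    (by rw [dist_comm, hsv]; linarith) (by rw [hvv']; linarith) (by rw [hsv']; linarith)
  refine ⟨g, hg, fun z hz => hfix z fun h => hz (hRO h), v, hRO (hmem t ht0.le htR),
    hsv.trans_le htη, ?_⟩
  rw [hs, hv, hsv, hsv']
  exact hlt t ht0.le htδ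

theorem IsUrysohn.isRich_lcGroup (hU : IsUrysohn U) {X : Set U} (hX : IsOpen X)
    {Γ : Set (ℝ → ℝ)} (hΓ : IsMCSemigroup Γ) (hΓc : MCCountablyGenerated Γ) :
    IsRich (lcGroup hΓ X) X where
  trans x V hV := by
    obtain ⟨R, hR, hRX, hRV⟩ := exists_ball_subset_nhds hX x hV
    refine ⟨ball x R, ball_mem_nhds x hR, fun y hy => ?_⟩
    obtain ⟨g, hg, hfix, hgx⟩ := hU.exists_isBiLipschitz_apply_eq hR hRX
      ((dist_comm x y).trans_le (mem_ball.1 hy).le)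
    refine ⟨⟨g, hg.mem_lcGroup hΓ⟩, fun z hz => ?_, hgx⟩
    by_contra hzV
    exact hz (hfix z fun h => hzV (hRV h))
  discrete x V hV := by
    obtain ⟨R, hR, hRX, hRV⟩ := exists_ball_subset_nhds hX x hV
    obtain ⟨y, hy0, hy⟩ := hU.exists_equidistant (x : U) hR
    have hmem : ∀ n, y n ∈ ball (x : U) (4 * R) := by
      intro n
      rw [mem_ball]
      rcases eq_or_ne n 0 with rfl | hn
      · rw [hy0, dist_self]
        linarith
      · rw [← hy0, hy n 0 hn]
        linarith
    exact ⟨R, hR, fun n => ⟨y n, hRX (hmem n)⟩, fun n => hRV (hmem n), fun m n hmn =>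
      (hy m n hmn).ge⟩
  bad x s O hs hO hsO := by
    obtain ⟨β, hβΓ, hβ⟩ := hΓc.exists_seq hΓ
    choose g hg hfix v hvO hsv hlt using fun n : ℕ =>
      hU.exists_expanding hX (hΓ.1 _ (hβΓ n)) (s n) ((hO n).mem_nhds (hsO n))
        (show (0 : ℝ) < 1 / (n + 1) by positivity)
    refine ⟨fun n => ⟨g n, (hg n).mem_lcGroup hΓ⟩, fun n z hz => ?_, fun k => ?_⟩
    · by_contra hzO
      exact hz (hfix n z hzO)
    · by_contra! hk
      have hv : Tendsto v atTop (𝓝 x) := by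
        refine hs.congr_dist (squeeze_zero (fun _ => dist_nonneg) hsv
          tendsto_one_div_add_atTop_nhds_zero_nat)
      obtain ⟨n, hn⟩ := k.2.1.exists_dist_le hβ hs hv
      have h1 : k.1 (s n) = g n (s n) := hk n _ (hsO n)
      have h2 : k.1 (v n) = g n (v n) := hk n _ (hvO n)
      rw [h1, h2] at hn
      exact (hlt n).not_ge hn
  glue := lcGroup_exists_glue hΓ

end Restrict

section Regularity

variable {U : Type} [MetricSpace U]

theorem IsMove.mono {L : ℝ} {O O' : Set U} {e : U ≃ U} (he : IsMove L O e) (h : O ⊆ O') :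
    IsMove L O' e where
  lip := he.lip
  lip_symm := he.lip_symm
  disp z w hw := he.disp z w fun hw' => hw (h hw')
  disp_symm z w hw := he.disp_symm z w fun hw' => hw (h hw')

theorem dist_le_of_glue {L : ℝ} (hL : 2 ≤ L) {O : ℕ → Set U} {e : ℕ → U → U} {k : U → U}
    (hlip : ∀ n z w, dist (e n z) (e n w) ≤ L * dist z w)
    (hdisp : ∀ n z, ∀ w ∉ O n, 2 * dist z (e n z) ≤ dist z w)
    (hk : ∀ n, ∀ z ∈ O n, k z = e n z) (hk' : ∀ z, (∀ n, z ∉ O n) → k z = z) (z w : U) :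
    dist (k z) (k w) ≤ L * dist z w := by
  by_cases h : ∃ n, z ∈ O n ∧ w ∈ O n
  · obtain ⟨n, hz, hw⟩ := h
    rw [hk n z hz, hk n w hw]
    exact hlip n z w
  · have key : ∀ z w : U, (¬ ∃ n, z ∈ O n ∧ w ∈ O n) → 2 * dist z (k z) ≤ dist z w := by
      intro z w h
      by_cases hz : ∃ n, z ∈ O n
      · obtain ⟨n, hn⟩ := hz
        rw [hk n z hn]
        exact hdisp n z w fun hw => h ⟨n, hn, hw⟩
      · rw [hk' z (not_exists.1 hz)]
        simp
    have h1 := key z w h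
    have h2 := key w z (by simpa only [and_comm] using h)
    have h3 := dist_triangle4 (k z) z w (k w)
    rw [dist_comm w z] at h2
    rw [dist_comm (k z) z] at h3
    nlinarith [dist_nonneg (x := z) (y := w)]

theorem IsUrysohn.exists_core (hU : IsUrysohn U) {A B : Set U} (hA : IsOpen A) (θ : A ≃ₜ B)
    {Λ : Set (ℝ → ℝ)} (hΛ : IsMCSemigroup Λ) (hΛc : MCCountablyGenerated Λ)
    (hθ : ∀ e : A ≃ₜ A, IsBiLipschitz e → LocallyGammaCont Λ (θ ∘ e ∘ θ.symm)) (x : A)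
    {V : Set A} (hV : V ∈ 𝓝 x) :
    ∃ x' ∈ V, ∃ β ∈ Λ, ∃ r > 0, ball (x' : U) r ⊆ A ∧
      ∀ u ∈ ball x' r, ∀ v ∈ ball x' r, ∀ p ∈ ball x' r, ∀ q ∈ ball x' r, dist u v = dist p q →
        dist (θ p) (θ q) ≤ β (dist (θ u) (θ v)) := by
  by_contra! hcon
  obtain ⟨β, hβΛ, hβ⟩ := hΛc.exists_seq hΛ
  obtain ⟨R, hR, hRA, hRV⟩ := exists_ball_subset_nhds hA x hV
  obtain ⟨γ, hγ, hγ0⟩ := hU.exists_line (x : U)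
  obtain ⟨c, r, hr, hdisj, hcx⟩ := exists_seq_disjoint_ball (x := (x : U)) (fun d hd => by
    have hd' : dist (γ (d / 2)) x = d / 2 := by
      rw [← hγ0, hγ.dist_eq, Real.dist_eq, sub_zero, abs_of_pos (by positivity)]
    refine ⟨γ (d / 2), fun h => ?_, by linarith⟩
    rw [h, dist_self] at hd'
    linarith) (show 0 < 4 * R by positivity)
  have hle : ∀ n : ℕ, 4 * R / (n + 1) ≤ 4 * R := fun n =>
    div_le_self (by positivity) (by linarith [(Nat.cast_nonneg n : (0 : ℝ) ≤ n)])
  have hcR : ∀ n, ball (c n) (r n) ⊆ ball (x : U) (4 * R) := fun n =>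
    (hcx n).trans (ball_subset_ball (hle n))
  have hcA : ∀ n, c n ∈ A := fun n => hRA (hcR n (mem_ball_self (hr n)))
  choose u hu v hv p hp q hq huv hlt using fun n => hcon ⟨c n, hcA n⟩
    (hRV (hcR n (mem_ball_self (hr n)))) (β n) (hβΛ n) (r n / 20) (by linarith [hr n])
    ((ball_subset_ball (by linarith [hr n])).trans ((hcR n).trans hRA))
  have hnear : ∀ n, ∀ a ∈ ball (⟨c n, hcA n⟩ : A) (r n / 20),
      ∀ b ∈ ball (⟨c n, hcA n⟩ : A) (r n / 20), dist a b ≤ r n / 10 := by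
    intro n a ha b hb
    rw [mem_ball] at ha hb
    linarith [dist_triangle_right a b ⟨c n, hcA n⟩]
  have hmove : ∀ n, ∃ e : U ≃ U, IsMove 2 (ball (c n) (r n)) e ∧ e (u n) = p n ∧ e (v n) = q n := by
    intro n
    obtain ⟨e, he, h1, h2⟩ := hU.exists_move le_rfl (show 0 < r n / 10 by linarith [hr n])
      (u := (u n : U)) (v := v n) (u' := p n) (v' := q n)
      (by linarith [show dist (u n : U) (v n) = dist (p n : U) (q n) from huv n,
        dist_nonneg (x := (u n : U)) (y := v n)])
      (by linarith [show dist (u n : U) (v n) = dist (p n : U) (q n) from huv n,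
        dist_nonneg (x := (u n : U)) (y := v n)])
      (hnear n _ (hu n) _ (hv n)) (hnear n _ (hu n) _ (hp n)) (hnear n _ (hu n) _ (hq n))
      (hnear n _ (hv n) _ (hp n)) (hnear n _ (hv n) _ (hq n)) (hnear n _ (hp n) _ (hq n))
    refine ⟨e, he.mono (ball_subset_ball' ?_), h1, h2⟩
    have : dist (u n : U) (c n) < r n / 20 := hu n
    linarith [hr n]
  choose e he heu hev using hmove
  obtain ⟨k, hk1, hk2, hk3, hk4⟩ := exists_perm_glue e (fun n => ball (c n) (r n)) hdisj
    fun n z hz => (he n).apply_eq_self hz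
  obtain ⟨g, hg, hgk⟩ := exists_isBiLipschitz_restrict (X := A) two_pos k
    (dist_le_of_glue le_rfl (fun n => (he n).lip) (fun n => (he n).disp) hk1 hk2)
    (dist_le_of_glue le_rfl (fun n => (he n).lip_symm) (fun n => (he n).disp_symm) hk3 hk4)
    fun z hz => hk2 z fun n hn => hz (hRA (hcR n hn))
  have hsub : ∀ n, ∀ a ∈ ball (⟨c n, hcA n⟩ : A) (r n / 20), (a : U) ∈ ball (c n) (r n) :=
    fun n a ha => ball_subset_ball (by linarith [hr n]) ha
  have hgu : ∀ n, g (u n) = p n := fun n => Subtype.ext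
    ((hgk _).trans ((hk1 n _ (hsub n _ (hu n))).trans (heu n)))
  have hgv : ∀ n, g (v n) = q n := fun n => Subtype.ext
    ((hgk _).trans ((hk1 n _ (hsub n _ (hv n))).trans (hev n)))
  have hlim : ∀ a : ℕ → A, (∀ n, a n ∈ ball (⟨c n, hcA n⟩ : A) (r n / 20)) →
      Tendsto (fun n => θ (a n)) atTop (𝓝 (θ x)) := by
    intro a ha
    refine (θ.continuous.tendsto x).comp ?_
    rw [tendsto_iff_dist_tendsto_zero]
    have hz : Tendsto (fun n : ℕ => 4 * R * (1 / (n + 1))) atTop (𝓝 0) := by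
      simpa using (tendsto_one_div_add_atTop_nhds_zero_nat (𝕜 := ℝ)).const_mul (4 * R)
    refine squeeze_zero (fun _ => dist_nonneg) (fun n => ?_) hz
    have : dist (a n : U) x < 4 * R / (n + 1) := hcx n (hsub n _ (ha n))
    rw [mul_one_div]
    exact this.le
  obtain ⟨n, hn⟩ := (hθ g hg).exists_dist_le hβ (hlim u hu) (hlim v hv)
  simp only [Function.comp_apply, Homeomorph.symm_apply_apply, hgu, hgv] at hn
  exact (hlt n).not_ge hn

theorem exists_lift_curve {X : Set U} {γ : ℝ → U} (hγ : Isometry γ) {D ρ : ℝ} (hD : 0 ≤ D)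
    (hDρ : D < ρ) (hX : ball (γ 0) ρ ⊆ X) :
    ∃ G : ℝ → X, Continuous G ∧ ∀ t ∈ Icc 0 D, (G t : U) = γ t := by
  have hmem : ∀ t ∈ Icc 0 D, γ t ∈ X := by
    intro t ht
    refine hX ?_
    rw [mem_ball, hγ.dist_eq, Real.dist_eq, sub_zero, abs_of_nonneg ht.1]
    exact ht.2.trans_lt hDρ
  refine ⟨fun t => ⟨γ (projIcc 0 D hD t), hmem _ (projIcc 0 D hD t).2⟩, ?_, fun t ht => ?_⟩
  · exact (hγ.continuous.comp (continuous_subtype_val.comp continuous_projIcc)).subtype_mk _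
  · simp only [projIcc_of_mem hD ht]

theorem IsUrysohn.exists_pair_ge (hU : IsUrysohn U) {A B : Set U} (θ : A ≃ₜ B) (x : A) {r : ℝ}
    (hr : 0 < r) (hA : ball (x : U) r ⊆ A) :
    ∃ c > 0, ∃ s₀ > 0, ∀ s, 0 < s → s < s₀ → ∃ p ∈ ball x r, ∃ q ∈ ball x r,
      dist p q = s ∧ c * s ≤ dist (θ p) (θ q) := by
  obtain ⟨γ, hγ, hγ0⟩ := hU.exists_line (x : U)
  set D : ℝ := r / 2 with hDdef
  have hD : 0 < D := by positivity
  obtain ⟨G, hGc, hG⟩ := exists_lift_curve hγ hD.le (show D < r by linarith) (hγ0 ▸ hA)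
  have hGd : ∀ s ∈ Icc 0 D, ∀ t ∈ Icc 0 D, dist (G s) (G t) = |s - t| := by
    intro s hs t ht
    rw [Subtype.dist_eq, hG s hs, hG t ht, hγ.dist_eq, Real.dist_eq]
  have h0D : (0 : ℝ) ∈ Icc 0 D := ⟨le_rfl, hD.le⟩
  have hG0 : G 0 = x := Subtype.ext ((hG 0 h0D).trans hγ0)
  have hGr : ∀ t ∈ Icc 0 D, G t ∈ ball x r := by
    intro t ht
    rw [mem_ball, ← hG0, hGd t ht 0 h0D, sub_zero, abs_of_nonneg ht.1]
    linarith [ht.2]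
  have hκ : 0 < dist (θ (G 0)) (θ (G D)) := by
    refine dist_pos.2 fun h => ?_
    have h1 := hGd 0 h0D D ⟨hD.le, le_rfl⟩
    rw [θ.injective h, dist_self, zero_sub, abs_neg, abs_of_pos hD] at h1
    linarith
  set κ := dist (θ (G 0)) (θ (G D)) with hκdef
  obtain ⟨η, hη, hcont⟩ := Metric.continuousAt_iff.1
    ((θ.continuous.comp hGc).continuousAt (x := D)) (κ / 2) (by positivity)
  refine ⟨κ / (2 * D), by positivity, min η D, lt_min hη hD, fun s hs hsη => ?_⟩
  rw [lt_min_iff] at hsη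
  by_contra! hcon
  set N := ⌊D / s⌋₊ with hN
  have hNs : N * s ≤ D := (le_div_iff₀ hs).1 (Nat.floor_le (by positivity))
  have hNs' : D < (N + 1) * s := (div_lt_iff₀ hs).1 (Nat.lt_floor_add_one _)
  have hin : ∀ i : ℕ, i ≤ N → (i : ℝ) * s ∈ Icc 0 D := by
    intro i hi
    have : (i : ℝ) ≤ N := Nat.cast_le.2 hi
    exact ⟨by positivity, by nlinarith⟩
  have hstep := dist_le_range_sum_of_dist_le (f := fun i : ℕ => θ (G (i * s))) N
    (d := fun _ => κ / (2 * D) * s) (fun {i} hi => by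
      refine (hcon _ (hGr _ (hin i hi.le)) _ (hGr _ (hin (i + 1) hi)) ?_).le
      rw [hGd _ (hin i hi.le) _ (hin (i + 1) hi)]
      push_cast
      rw [show (i : ℝ) * s - (i + 1) * s = -s by ring, abs_neg, abs_of_pos hs])
  have hlast : dist (θ (G (N * s))) (θ (G D)) < κ / 2 := by
    refine hcont ?_
    rw [Real.dist_eq, abs_sub_comm, abs_of_nonneg (by linarith)]
    linarith [hsη.1]
  simp only [Nat.cast_zero, zero_mul, Finset.sum_const, Finset.card_range, nsmul_eq_mul] at hstep
  have hsum : (N : ℝ) * (κ / (2 * D) * s) ≤ κ / 2 := by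
    calc (N : ℝ) * (κ / (2 * D) * s) = κ / (2 * D) * (N * s) := by ring
      _ ≤ κ / (2 * D) * D := by gcongr
      _ = κ / 2 := by field_simp
  linarith [dist_triangle (θ (G 0)) (θ (G (N * s))) (θ (G D))]

theorem IsUrysohn.exists_pair_le (hU : IsUrysohn U) {A B : Set U} (hB : IsOpen B) (θ : A ≃ₜ B)
    (x : A) {r : ℝ} (hr : 0 < r) :
    ∃ C > 0, ∃ s₀ > 0, ∀ s, 0 < s → s < s₀ → ∃ u ∈ ball x r, ∃ v ∈ ball x r,
      dist u v = s ∧ dist (θ u) (θ v) ≤ C * s := by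
  have hV : θ.symm ⁻¹' ball x r ∈ 𝓝 (θ x) := by
    refine θ.symm.continuous.continuousAt.preimage_mem_nhds ?_
    rw [θ.symm_apply_apply]
    exact ball_mem_nhds x hr
  obtain ⟨ρ, hρ, hρB, hρV⟩ := exists_ball_subset_nhds hB (θ x) hV
  obtain ⟨c, hc, s₀, hs₀, h⟩ := hU.exists_pair_ge θ.symm (θ x) hρ
    ((ball_subset_ball (by linarith)).trans hρB)
  refine ⟨1 / c, by positivity, s₀ * c, by positivity, fun s hs hss => ?_⟩
  obtain ⟨p, hp, q, hq, hpq, hge⟩ := h (s / c) (by positivity) ((div_lt_iff₀ hc).2 hss)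
  rw [mul_div_cancel₀ _ hc.ne'] at hge
  have hpq2 : dist (p : U) q < 2 * ρ := by
    have h1 : dist (p : U) (θ x) < ρ := hp
    have h2 : dist (q : U) (θ x) < ρ := hq
    linarith [dist_triangle_right (p : U) q (θ x)]
  obtain ⟨γ, hγ, h0, h1⟩ := hU.exists_geodesic (p : U) q
  have hball : ball (p : U) (2 * ρ) ⊆ ball (θ x : U) (4 * ρ) := by
    refine ball_subset_ball' ?_
    have h1 : dist (p : U) (θ x) < ρ := hp
    linarith
  obtain ⟨G, hGc, hG⟩ := exists_lift_curve hγ dist_nonneg hpq2 (h0 ▸ hball.trans hρB)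
  have hG0 : G 0 = p := Subtype.ext ((hG 0 ⟨le_rfl, dist_nonneg⟩).trans h0)
  have hG1 : G (dist (p : U) q) = q := Subtype.ext ((hG _ ⟨dist_nonneg, le_rfl⟩).trans h1)
  have hivt := intermediate_value_Icc (dist_nonneg (x := (p : U)) (y := q))
    (f := fun t => dist (θ.symm p) (θ.symm (G t)))
    (continuous_const.dist (θ.symm.continuous.comp hGc)).continuousOn
  obtain ⟨t, ht, hts⟩ := hivt (show s ∈ Icc _ _ by
    simp only [hG0, hG1, dist_self]
    exact ⟨hs.le, hge⟩)
  have hpt : dist (p : U) (G t) = t := by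
    rw [hG t ht, ← h0, hγ.dist_eq, Real.dist_eq, zero_sub, abs_neg, abs_of_nonneg ht.1]
  refine ⟨θ.symm p, hρV (ball_subset_ball (by linarith) hp), θ.symm (G t), hρV ?_, hts, ?_⟩
  · refine hball ?_
    rw [mem_ball, dist_comm, hpt]
    exact ht.2.trans_lt hpq2
  · rw [θ.apply_symm_apply, θ.apply_symm_apply, Subtype.dist_eq, hpt]
    refine ht.2.trans (le_of_eq ?_)
    rw [show dist (p : U) q = s / c from hpq]
    ring

theorem IsUrysohn.locallyGammaBicont_of_conj (hU : IsUrysohn U) {A B : Set U} (hA : IsOpen A)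
    (hB : IsOpen B) (θ : A ≃ₜ B) {Λ : Set (ℝ → ℝ)} (hΛ : IsMCSemigroup Λ)
    (hΛc : MCCountablyGenerated Λ)
    (hθ : ∀ e : A ≃ₜ A, IsBiLipschitz e → LocallyGammaCont Λ (θ ∘ e ∘ θ.symm)) :
    LocallyGammaBicont Λ θ := by
  have key : ∀ x : A, GammaContAt Λ θ x ∧ GammaContAt Λ θ.symm (θ x) := by
    intro x
    obtain ⟨R, hR, hRA, -⟩ := exists_ball_subset_nhds hA x univ_mem
    obtain ⟨x', hx', β, hβ, r, hr, hrA, hcore⟩ := hU.exists_core hA θ hΛ hΛc hθ x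
      (ball_mem_nhds x hR)
    obtain ⟨C, hC, s₀, hs₀, hsmall⟩ := hU.exists_pair_le hB θ x' hr
    obtain ⟨c, hc, s₁, hs₁, hbig⟩ := hU.exists_pair_ge θ x' hr hrA
    have hβm := hΛ.1 β hβ
    have hfwd : GammaContAt Λ θ x' := by
      refine ⟨min r (s₀ / 2), by positivity, _, hΛ.2.2.1 _ hβ _ (hΛ.const_mul_mem hC), ?_⟩
      intro p q hp hq
      rw [lt_min_iff] at hp hq
      rcases eq_or_ne p q with rfl | hpq
      · simp [hβm.1]
      · obtain ⟨u, hu, v, hv, huv, hle⟩ := hsmall (dist p q) (dist_pos.2 hpq)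
          (by linarith [dist_triangle_right p q x'])
        exact (hcore u hu v hv p hp.1 q hq.1 huv).trans (hβm.le_of_le dist_nonneg hle)
    have hbwd : GammaContAt Λ θ.symm (θ x') := by
      obtain ⟨ε, hε, hball⟩ := Metric.continuousAt_iff.1
        (θ.symm.continuous.continuousAt (x := θ x')) (min r (s₁ / 2)) (by positivity)
      refine ⟨ε, hε, _, hΛ.2.2.1 _ (hΛ.const_mul_mem (inv_pos.2 hc)) _ hβ, ?_⟩
      intro a b ha hb
      have hu := hball ha
      have hv := hball hb
      rw [θ.symm_apply_apply, lt_min_iff] at hu hv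
      rcases eq_or_ne a b with rfl | hab
      · simp [hβm.1]
      · obtain ⟨p, hp, q, hq, hpq, hge⟩ := hbig (dist (θ.symm a) (θ.symm b))
          (dist_pos.2 (θ.symm.injective.ne hab))
          (by linarith [dist_triangle_right (θ.symm a) (θ.symm b) x'])
        have h1 := hcore _ hu.1 _ hv.1 p hp q hq hpq.symm
        rw [θ.apply_symm_apply, θ.apply_symm_apply] at h1
        rw [Function.comp_apply, ← div_eq_inv_mul, le_div_iff₀ hc, mul_comm]
        exact hge.trans h1
    obtain ⟨e, he, -, hex⟩ := hU.exists_isBiLipschitz_apply_eq hR hRA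
      ((dist_comm x x').trans_le (mem_ball.1 hx').le)
    have heΛ := he.mem_lcGroup hΛ
    constructor
    · have h1 : GammaContAt Λ (θ ∘ e) x :=
        GammaContAt.comp hΛ (hex ▸ hfwd) (heΛ.1 x) e.continuous.continuousAt
      have h2 := GammaContAt.comp hΛ (hθ _ he.symm _) h1 (θ.continuous.comp e.continuous).continuousAt
      convert h2 using 1
      ext z
      simp
    · have hc : Continuous (θ ∘ e ∘ θ.symm) :=
        θ.continuous.comp (e.continuous.comp θ.symm.continuous)
      have h1 : GammaContAt Λ (θ.symm ∘ (θ ∘ e ∘ θ.symm)) (θ x) := by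
        refine GammaContAt.comp hΛ ?_ (hθ e he _) hc.continuousAt
        simpa [hex] using hbwd
      have h2 := GammaContAt.comp hΛ (heΛ.2 _) h1 (θ.symm.continuous.comp hc).continuousAt
      convert h2 using 1
      ext z
      simp
  exact ⟨fun x => (key x).1, fun y => θ.apply_symm_apply y ▸ (key (θ.symm y)).2⟩

end Regularity

/-- Reconstruction theorem: a group isomorphism between the groups of locally
`Γ`- resp. `Δ`-bicontinuous auto-homeomorphisms of nonempty open subsets `X`,
`Y` of the Urysohn space is induced by a conjugating homeomorphism `τ : X → Y`
which is both locally `Γ`-bicontinuous and locally `Δ`-bicontinuous. -/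
theorem reconstruction_theorem (U : Type) [MetricSpace U] (hU : IsUrysohn U)
    (X Y : Set U) (hX : IsOpen X) (hXne : X.Nonempty)
    (hY : IsOpen Y) (hYne : Y.Nonempty)
    (Γ Δ : Set (ℝ → ℝ))
    (hΓ : IsMCSemigroup Γ) (hΓc : MCCountablyGenerated Γ)
    (hΔ : IsMCSemigroup Δ) (hΔc : MCCountablyGenerated Δ)
    (φ : (↥X ≃ₜ ↥X) → (↥Y ≃ₜ ↥Y))
    (hφbij : BijOn φ {g : ↥X ≃ₜ ↥X | LocallyGammaBicont Γ g}
      {g : ↥Y ≃ₜ ↥Y | LocallyGammaBicont Δ g})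
    (hφmul : ∀ g ∈ {g : ↥X ≃ₜ ↥X | LocallyGammaBicont Γ g},
      ∀ h ∈ {g : ↥X ≃ₜ ↥X | LocallyGammaBicont Γ g},
        φ (g.trans h) = (φ g).trans (φ h)) :
    ∃ τ : ↥X ≃ₜ ↥Y, LocallyGammaBicont Γ τ ∧ LocallyGammaBicont Δ τ ∧
      ∀ g ∈ {g : ↥X ≃ₜ ↥X | LocallyGammaBicont Γ g},
        φ g = (τ.symm.trans (g.trans τ)) := by
  have hinj : Function.Injective fun g : lcGroup hΓ X =>
      (⟨φ g.1, hφbij.mapsTo g.2⟩ : lcGroup hΔ Y) := fun g h hgh =>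
    Subtype.ext (hφbij.injOn g.2 h.2 (congrArg Subtype.val hgh))
  have hsurj : Function.Surjective fun g : lcGroup hΓ X =>
      (⟨φ g.1, hφbij.mapsTo g.2⟩ : lcGroup hΔ Y) := by
    intro h
    obtain ⟨g, hg, hgh⟩ := hφbij.surjOn h.2
    exact ⟨⟨g, hg⟩, Subtype.ext hgh⟩
  let Φ : lcGroup hΓ X ≃* lcGroup hΔ Y :=
    { Equiv.ofBijective _ ⟨hinj, hsurj⟩ with
      map_mul' := fun g h => Subtype.ext (hφmul h.1 h.2 g.1 g.2) }
  obtain ⟨τ, hτ⟩ := (hU.isRich_lcGroup hX hΓ hΓc).exists_homeomorph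
    (hU.isRich_lcGroup hY hΔ hΔc) Φ
  have hconj : ∀ g : lcGroup hΓ X, (Φ g).1 = τ.symm.trans (g.1.trans τ) := by
    intro g
    ext1 y
    have h := hτ g (τ.symm y)
    rw [τ.apply_symm_apply] at h
    exact h.symm
  refine ⟨τ, ?_, ?_, fun g hg => hconj ⟨g, hg⟩⟩
  · have h := hU.locallyGammaBicont_of_conj hY hX τ.symm hΓ hΓc fun e he => by
      have h1 := (Φ.symm ⟨e, he.mem_lcGroup hΔ⟩).2.1
      have h2 := hconj (Φ.symm ⟨e, he.mem_lcGroup hΔ⟩)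
      rw [Φ.apply_symm_apply] at h2
      convert h1 using 1
      ext1 x
      have h3 := congrArg (fun k : Y ≃ₜ Y => τ.symm (k (τ x))) h2
      simpa using h3
    exact ⟨h.2, h.1⟩
  · refine hU.locallyGammaBicont_of_conj hX hY τ hΔ hΔc fun e he => ?_
    have h1 := (Φ ⟨e, he.mem_lcGroup hΓ⟩).2.1
    rw [hconj] at h1
    exact h1
end
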